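/- arXiv:1108.2871 — 2 statements merged into one kernel-verified Lean document; each statement's English description precedes it below -/
import Mathlib

section
/- There is a constant γ > 0 such that every 3-regular (cubic) graph G with vertex set V in which every cut δ(U) with 2 ≤ |U| ≤ |V| − 2 satisfies |δ(U)| ≥ 4, has at least 2^(γ|V|) distinct perfect matchings. -/
open Finset

open scoped Classical in
/-- The edges with exactly one end in `U`, in the multigraph whose edge `e` joins `a e` and `b e`. -/
noncomputable def edgeCut {V E : Type} [Fintype E] (a b : E → V) (U : Finset V) : Finset E :=
  {e | ¬(a e ∈ U ↔ b e ∈ U)}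

/-- The inequalities describing the perfect matching polytope. -/
structure OddCutFeasible {V E : Type} [Fintype E] (a b : E → V) (x : E → ℝ) : Prop where
  nonneg : ∀ e, 0 ≤ x e
  loop : ∀ e, a e = b e → x e = 0
  degree : ∀ v, ∑ e ∈ edgeCut a b {v}, x e = 1
  odd : ∀ U : Finset V, Odd #U → 1 ≤ ∑ e ∈ edgeCut a b U, x e

/-- `M` meets the star of every vertex in exactly one edge. -/
def IsPerfectEdgeSet {V E : Type} [Fintype E] (a b : E → V) (M : Finset E) : Prop :=
  ∀ v, ∃! e, e ∈ M ∧ e ∈ edgeCut a b {v}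

section Polytope

variable {V E : Type} [Fintype E] {a b : E → V} {x : E → ℝ}

theorem mem_edgeCut {U : Finset V} {e : E} : e ∈ edgeCut a b U ↔ ¬(a e ∈ U ↔ b e ∈ U) := by
  simp [edgeCut]

theorem mem_edgeCut_singleton {v : V} {e : E} : e ∈ edgeCut a b {v} ↔ ¬(a e = v ↔ b e = v) := by
  simp [edgeCut]

theorem OddCutFeasible.ne_of_pos (hx : OddCutFeasible a b x) {e : E} (he : 0 < x e) : a e ≠ b e :=
  fun h ↦ he.ne' (hx.loop e h)

theorem OddCutFeasible.exists_perfect_support [Fintype V] (hx : OddCutFeasible a b x) :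
    ∃ M : Finset E, (∀ e ∈ M, 0 < x e) ∧ IsPerfectEdgeSet a b M := by
  classical
  let H : SimpleGraph V :=
    { Adj := fun u v ↦ u ≠ v ∧ ∃ e, 0 < x e ∧ s(a e, b e) = s(u, v)
      symm := ⟨fun u v ⟨h, e, he, h'⟩ ↦ ⟨h.symm, e, he, h'.trans Sym2.eq_swap⟩⟩
      loopless := ⟨fun u h ↦ h.1 rfl⟩ }
  have hH : ∃ M : H.Subgraph, M.IsPerfectMatching := by
    refine SimpleGraph.tutte.mpr fun S hS ↦ ?_
    unfold SimpleGraph.IsTutteViolator at hS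
    set K := ((⊤ : H.Subgraph).deleteVerts S).coe with hK
    let comp : K.ConnectedComponent → Finset V := fun c ↦
      {v | ∃ h : v ∈ ((⊤ : H.Subgraph).deleteVerts S).verts, K.connectedComponentMk ⟨v, h⟩ = c}
    have hcomp : ∀ c v, v ∈ comp c ↔
        ∃ h : v ∈ ((⊤ : H.Subgraph).deleteVerts S).verts, K.connectedComponentMk ⟨v, h⟩ = c := by
      simp [comp]
    have hcard : ∀ c, #(comp c) = c.supp.ncard := by
      intro c
      rw [← Set.ncard_image_of_injective _ Subtype.val_injective, ← Set.ncard_coe_finset]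
      congr 1
      ext v
      rw [mem_coe, hcomp]
      simp [SimpleGraph.ConnectedComponent.mem_supp_iff]
    have hcross : ∀ c u w e, 0 < x e → s(a e, b e) = s(u, w) → u ∈ comp c → w ∉ comp c →
        w ∈ S := by
      intro c u w e he huw hu hw
      by_contra hwS
      obtain ⟨hu', rfl⟩ := (hcomp _ _).1 hu
      have hw' : w ∈ ((⊤ : H.Subgraph).deleteVerts S).verts := by simp [hwS]
      refine hw ((hcomp _ _).2 ⟨hw', ?_⟩)
      rw [SimpleGraph.ConnectedComponent.eq]
      apply SimpleGraph.Adj.reachable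
      have huS : u ∉ S := by simpa using hu'
      have : H.Adj u w := ⟨fun h ↦ hw (h ▸ hu), e, he, huw⟩
      simp [K, hwS, huS, this.symm]
    let oc : Finset K.ConnectedComponent := {c | Odd c.supp.ncard}
    have hoc : K.oddComponents.ncard = #oc := by
      rw [← Set.ncard_coe_finset]; simp [oc]
    have hSc : S.ncard = #S.toFinset := by rw [Set.ncard_eq_toFinset_card']
    rw [hoc, hSc] at hS
    have h1 : (#oc : ℝ) ≤ ∑ c ∈ oc, ∑ e ∈ edgeCut a b (comp c), x e := by
      rw [← nsmul_one, ← Finset.sum_const]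
      refine sum_le_sum fun c hc ↦ hx.odd _ ?_
      rw [hcard]
      simpa [oc] using hc
    have h2 : ∑ v ∈ S.toFinset, ∑ e ∈ edgeCut a b {v}, x e = #S.toFinset := by
      simp [hx.degree]
    have h3 : ∑ c ∈ oc, ∑ e ∈ edgeCut a b (comp c), x e ≤
        ∑ v ∈ S.toFinset, ∑ e ∈ edgeCut a b {v}, x e := by
      have key : ∀ {ι : Type} (s : Finset ι) (f : ι → Finset V),
          ∑ i ∈ s, ∑ e ∈ edgeCut a b (f i), x e =
            ∑ e, #{i ∈ s | e ∈ edgeCut a b (f i)} * x e := by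
        intro ι s f
        have : ∀ i, ∑ e ∈ edgeCut a b (f i), x e =
            ∑ e, if e ∈ edgeCut a b (f i) then x e else 0 := by
          intro i; rw [← sum_filter]; simp
        simp_rw [this]
        rw [sum_comm]
        refine sum_congr rfl fun e _ ↦ ?_
        rw [← sum_filter, sum_const, nsmul_eq_mul]
      rw [key, key]
      refine sum_le_sum fun e _ ↦ ?_
      rcases (hx.nonneg e).eq_or_lt with h0 | hpos
      · simp [← h0]
      refine mul_le_mul_of_nonneg_right ?_ hpos.le
      rw [Nat.cast_le]
      obtain hem | ⟨c, hc⟩ := Finset.eq_empty_or_nonempty {i ∈ oc | e ∈ edgeCut a b (comp i)}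
      · simp [hem]
      obtain ⟨u, w, huw, hu, hw⟩ : ∃ u w, s(a e, b e) = s(u, w) ∧ u ∈ comp c ∧ w ∉ comp c := by
        have := mem_edgeCut.1 (mem_filter.1 hc).2
        by_cases h : a e ∈ comp c
        · exact ⟨a e, b e, rfl, h, by tauto⟩
        · exact ⟨b e, a e, Sym2.eq_swap, by tauto, h⟩
      have hwS := hcross c u w e hpos huw hu hw
      have huS : ∀ c v, v ∈ comp c → v ∉ S := fun c v hv ↦ by
        obtain ⟨h, -⟩ := (hcomp _ _).1 hv
        simpa using h
      have hone : #{i ∈ oc | e ∈ edgeCut a b (comp i)} ≤ 1 := by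
        have : Nonempty K.ConnectedComponent := ⟨c⟩
        rw [card_le_one_iff_subset_singleton]
        refine ⟨c, fun d hd ↦ ?_⟩
        have hd := mem_edgeCut.1 (mem_filter.1 hd).2
        have hwd : w ∉ comp d := fun h ↦ huS _ _ h hwS
        have hud : u ∈ comp d := by
          rcases Sym2.eq_iff.1 huw with ⟨h1, h2⟩ | ⟨h1, h2⟩ <;> rw [h1, h2] at hd <;> tauto
        obtain ⟨_, h1⟩ := (hcomp _ _).1 hud
        obtain ⟨_, h2⟩ := (hcomp _ _).1 hu
        simp [← h1, ← h2]
      refine hone.trans (Finset.card_pos.2 ⟨w, ?_⟩)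
      have hne : u ≠ w := fun h ↦ hw (h ▸ hu)
      simp only [mem_filter, Set.mem_toFinset, hwS, true_and, mem_edgeCut_singleton]
      rcases Sym2.eq_iff.1 huw with ⟨h1, h2⟩ | ⟨h1, h2⟩ <;> rw [h1, h2] <;> tauto
    have h4 := (h1.trans h3).trans_eq h2
    rw [Nat.cast_le] at h4
    omega
  obtain ⟨N, hN⟩ := hH
  rw [SimpleGraph.Subgraph.isPerfectMatching_iff] at hN
  choose p hp hp' using hN
  have hedge : ∀ v, ∃ e, 0 < x e ∧ s(a e, b e) = s(v, p v) := fun v ↦ (N.adj_sub (hp v)).2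
  have hpp : ∀ v, p (p v) = v := fun v ↦ (hp' _ _ (hp v).symm).symm
  have hne : ∀ v, v ≠ p v := fun v ↦ (N.adj_sub (hp v)).1
  let g : Sym2 V → Option E := fun z ↦
    if h : ∃ e, 0 < x e ∧ s(a e, b e) = z then some h.choose else none
  have hg : ∀ v, ∃ e, g s(v, p v) = some e ∧ 0 < x e ∧ s(a e, b e) = s(v, p v) := fun v ↦
    ⟨(hedge v).choose, by simp only [g]; rw [dif_pos (hedge v)], (hedge v).choose_spec⟩
  choose m hm hm0 hm1 using hg
  have hmp : ∀ v, m (p v) = m v := by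
    intro v
    have := hm (p v)
    rw [hpp, Sym2.eq_swap, hm v] at this
    exact (Option.some.inj this).symm
  refine ⟨univ.image m, by simpa using hm0, fun v ↦ ⟨m v, ⟨by simp, ?_⟩, ?_⟩⟩
  · have h0 := hne v
    rw [mem_edgeCut_singleton]
    rcases Sym2.eq_iff.1 (hm1 v) with ⟨h1, h2⟩ | ⟨h1, h2⟩ <;> rw [h1, h2] <;> tauto
  · rintro e ⟨he, hev⟩
    obtain ⟨w, -, rfl⟩ := mem_image.1 he
    rw [mem_edgeCut_singleton] at hev
    have : v = w ∨ v = p w := by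
      rcases Sym2.eq_iff.1 (hm1 w) with ⟨h1, h2⟩ | ⟨h1, h2⟩ <;> rw [h1, h2] at hev <;> tauto
    rcases this with rfl | rfl
    · rfl
    · exact (hmp w).symm

end Polytope

section Contraction

variable {V E : Type} [Fintype E] {a b : E → V} {x : E → ℝ} {U : Finset V}

open scoped Classical in
/-- Contraction of `U` to the single vertex `none`. -/
noncomputable def contractMap (U : Finset V) (v : V) : Option {v // v ∉ U} :=
  if h : v ∈ U then none else some ⟨v, h⟩

theorem contractMap_eq_none {v : V} : contractMap U v = none ↔ v ∈ U := by
  simp [contractMap]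

theorem contractMap_eq_some {v : V} {w : {v // v ∉ U}} : contractMap U v = some w ↔ v = w := by
  unfold contractMap
  split_ifs with h
  · simpa using fun h' : v = w ↦ w.2 (h' ▸ h)
  · simp [Subtype.ext_iff]

theorem edgeCut_compl [Fintype V] [DecidableEq V] : edgeCut a b Uᶜ = edgeCut a b U := by
  ext e
  simp only [mem_edgeCut, mem_compl]
  tauto

open scoped Classical in
/-- The weights of the contracted multigraph: edges that become loops get weight zero. -/
noncomputable def contractWeight (a b : E → V) (x : E → ℝ) (U : Finset V) (e : E) : ℝ :=
  if contractMap U (a e) = contractMap U (b e) then 0 else x e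

open scoped Classical in
theorem OddCutFeasible.contract [Fintype V] (hx : OddCutFeasible a b x) (hU : Odd #U)
    (ht : ∑ e ∈ edgeCut a b U, x e = 1) :
    OddCutFeasible (contractMap U ∘ a) (contractMap U ∘ b) (contractWeight a b x U) := by
  have hcut : ∀ W, edgeCut (contractMap U ∘ a) (contractMap U ∘ b) W =
      edgeCut a b {v | contractMap U v ∈ W} := by
    intro W; ext e; simp [mem_edgeCut]
  have hsum : ∀ W, ∑ e ∈ edgeCut (contractMap U ∘ a) (contractMap U ∘ b) W,
      contractWeight a b x U e = ∑ e ∈ edgeCut a b {v | contractMap U v ∈ W}, x e := by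
    intro W
    rw [hcut]
    refine sum_congr rfl fun e he ↦ if_neg fun h ↦ ?_
    simp [mem_edgeCut, h] at he
  have hnone : ({v | contractMap U v = none} : Finset V) = U := by
    ext v; simp [contractMap_eq_none]
  have hsome : ∀ w : {v // v ∉ U}, ({v | contractMap U v = some w} : Finset V) = {w.1} := by
    intro w; ext v; simp [contractMap_eq_some]
  refine ⟨fun e ↦ ?_, fun e he ↦ if_pos he, fun v ↦ ?_, fun W hW ↦ ?_⟩
  · unfold contractWeight
    split_ifs
    exacts [le_rfl, hx.nonneg e]
  · rw [hsum]
    rcases v with _ | w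
    · simpa [hnone] using ht
    · simpa [hsome] using hx.degree w
  · rw [hsum]
    refine hx.odd _ ?_
    rw [card_eq_sum_card_fiberwise (f := contractMap U) (t := W) (by intro v hv; simpa using hv),
      odd_sum_iff_odd_card_odd, filter_true_of_mem]
    · exact hW
    · intro v hv
      rw [filter_filter, filter_congr (q := fun u ↦ contractMap U u = v)
        fun u _ ↦ ⟨fun h ↦ h.2, fun h ↦ ⟨h ▸ hv, h⟩⟩]
      rcases v with _ | w
      · rwa [hnone]
      · simp [hsome]

/-- Every linear functional has a perfect edge set in the support of `x` where its value is at
most its value at `x`. -/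
def DominatedByPerfect (a b : E → V) (x : E → ℝ) : Prop :=
  ∀ s : E → ℝ, ∃ M : Finset E, (∀ e ∈ M, 0 < x e) ∧ IsPerfectEdgeSet a b M ∧
    ∑ e ∈ M, s e ≤ ∑ e, s e * x e

/-- The sets of edges corresponding to perfect edge sets of the contraction of `U`. -/
structure IsPerfectOutside (a b : E → V) (x : E → ℝ) (U : Finset V) (M : Finset E) : Prop where
  pos : ∀ e ∈ M, 0 < x e
  outside : ∀ e ∈ M, ¬(a e ∈ U ∧ b e ∈ U)
  cut : ∃! e, e ∈ M ∧ e ∈ edgeCut a b U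
  vertex : ∀ v ∉ U, ∃! e, e ∈ M ∧ e ∈ edgeCut a b {v}

open scoped Classical in
theorem DominatedByPerfect.exists_outside (hx : OddCutFeasible a b x)
    (h : DominatedByPerfect (contractMap U ∘ a) (contractMap U ∘ b) (contractWeight a b x U))
    (s : E → ℝ) : ∃ M, IsPerfectOutside a b x U M ∧
      ∑ e ∈ M, s e ≤ ∑ e, s e * (if a e ∈ U ∧ b e ∈ U then 0 else x e) := by
  obtain ⟨M, hpos, hM, hs⟩ := h s
  have hsub : ∀ e ∈ M, contractMap U (a e) ≠ contractMap U (b e) ∧ 0 < x e := by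
    intro e he
    have := hpos e he
    unfold contractWeight at this
    split_ifs at this with h'
    · exact absurd this (lt_irrefl _)
    · exact ⟨h', this⟩
  refine ⟨M, ⟨fun e he ↦ (hsub e he).2, fun e he hU ↦ (hsub e he).1 ?_, ?_, fun v hv ↦ ?_⟩, ?_⟩
  · rw [contractMap_eq_none.2 hU.1, contractMap_eq_none.2 hU.2]
  · simpa [mem_edgeCut, mem_edgeCut_singleton, contractMap_eq_none] using hM none
  · simpa [mem_edgeCut_singleton, contractMap_eq_some] using hM (some ⟨v, hv⟩)
  · refine hs.trans_eq (sum_congr rfl fun e _ ↦ ?_)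
    unfold contractWeight
    by_cases hU : a e ∈ U ∧ b e ∈ U
    · rw [if_pos hU, contractMap_eq_none.2 hU.1, contractMap_eq_none.2 hU.2, if_pos rfl]
    rw [if_neg hU]
    split_ifs with h'
    · rcases hb : contractMap U (b e) with _ | w
      · rw [hb] at h'
        exact absurd ⟨contractMap_eq_none.1 h', contractMap_eq_none.1 hb⟩ hU
      · rw [hb] at h'
        rw [hx.loop e ((contractMap_eq_some.1 h').trans (contractMap_eq_some.1 hb).symm)]
    · rfl

open scoped Classical in
/-- Cheapest completions of the cut edges satisfy an averaged bound. -/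
theorem exists_completion_cost
    (h : ∀ s : E → ℝ, ∃ M, IsPerfectOutside a b x U M ∧
      ∑ e ∈ M, s e ≤ ∑ e, s e * (if a e ∈ U ∧ b e ∈ U then 0 else x e)) (s : E → ℝ) :
    ∃ N : E → Finset E, (∀ e ∈ edgeCut a b U, 0 < x e → IsPerfectOutside a b x U (N e) ∧ e ∈ N e) ∧
      ∑ e ∈ edgeCut a b U, x e * ∑ f ∈ N e \ edgeCut a b U, s f ≤
        ∑ e ∈ (edgeCut a b U)ᶜ, s e * (if a e ∈ U ∧ b e ∈ U then 0 else x e) := by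
  have hcutU : ∀ e ∈ edgeCut a b U, ¬(a e ∈ U ∧ b e ∈ U) := fun e he h ↦ by
    rw [mem_edgeCut] at he; tauto
  have hmin : ∀ e, ∃ N : Finset E, e ∈ edgeCut a b U → 0 < x e →
      (IsPerfectOutside a b x U N ∧ e ∈ N) ∧ ∀ M, IsPerfectOutside a b x U M → e ∈ M →
        ∑ f ∈ N \ edgeCut a b U, s f ≤ ∑ f ∈ M \ edgeCut a b U, s f := by
    intro e
    by_cases he : e ∈ edgeCut a b U ∧ 0 < x e
    swap
    · exact ⟨∅, fun h1 h2 ↦ absurd ⟨h1, h2⟩ he⟩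
    obtain ⟨M, hM, hs⟩ := h (fun f ↦ if f = e then -1 else 0)
    have heM : e ∈ M := by
      by_contra heM
      simp only [sum_ite_eq', heM, if_false, ite_mul, zero_mul, mem_univ, if_true,
        hcutU e he.1] at hs
      linarith [he.2]
    obtain ⟨N, hN, hmin⟩ := exists_min_image
      ({M | IsPerfectOutside a b x U M ∧ e ∈ M} : Finset (Finset E))
      (fun M ↦ ∑ f ∈ M \ edgeCut a b U, s f) ⟨M, by simp [hM, heM]⟩
    exact ⟨N, fun _ _ ↦ ⟨by simpa using hN, fun M' h1 h2 ↦ hmin M' (by simp [h1, h2])⟩⟩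
  choose N hN using hmin
  refine ⟨N, fun e he hpos ↦ (hN e he hpos).1, ?_⟩
  set t : E → ℝ := fun e ↦ ∑ f ∈ N e \ edgeCut a b U, s f with ht
  obtain ⟨M, hM, hs⟩ := h (fun f ↦ if f ∈ edgeCut a b U then -t f else s f)
  obtain ⟨e, ⟨heM, heC⟩, huniq⟩ := hM.cut
  have hinter : M ∩ edgeCut a b U = {e} := by
    ext f
    simp only [mem_inter, mem_singleton]
    exact ⟨huniq f, by rintro rfl; exact ⟨heM, heC⟩⟩
  have hcost := (hN e heC (hM.pos e heM)).2 M hM heM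
  rw [← sum_inter_add_sum_sdiff M (edgeCut a b U), hinter, sum_singleton, if_pos heC,
    ← sum_add_sum_compl (edgeCut a b U)] at hs
  have h1 : ∑ f ∈ M \ edgeCut a b U, (if f ∈ edgeCut a b U then -t f else s f) =
      ∑ f ∈ M \ edgeCut a b U, s f :=
    sum_congr rfl fun f hf ↦ if_neg (mem_sdiff.1 hf).2
  have h2 : ∑ f ∈ edgeCut a b U, (if f ∈ edgeCut a b U then -t f else s f) *
      (if a f ∈ U ∧ b f ∈ U then 0 else x f) = -∑ f ∈ edgeCut a b U, x f * t f := by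
    rw [← sum_neg_distrib]
    refine sum_congr rfl fun f hf ↦ ?_
    rw [if_pos hf, if_neg (hcutU f hf)]; ring
  have h3 : ∑ f ∈ (edgeCut a b U)ᶜ, (if f ∈ edgeCut a b U then -t f else s f) *
      (if a f ∈ U ∧ b f ∈ U then 0 else x f) =
      ∑ f ∈ (edgeCut a b U)ᶜ, s f * (if a f ∈ U ∧ b f ∈ U then 0 else x f) :=
    sum_congr rfl fun f hf ↦ by rw [if_neg (mem_compl.1 hf)]
  rw [h1, h2, h3] at hs
  linarith

theorem IsPerfectOutside.existsUnique_union [Fintype V] [DecidableEq V] [DecidableEq E]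
    {M N : Finset E} {f : E}
    (hM : IsPerfectOutside a b x U M) (hN : IsPerfectOutside a b x Uᶜ N)
    (hfC : f ∈ edgeCut a b U) (hfM : f ∈ M) (hfN : f ∈ N) {v : V} (hv : v ∉ U) :
    ∃! e, e ∈ M ∪ N ∧ e ∈ edgeCut a b {v} := by
  obtain ⟨e, ⟨he, hev⟩, huniq⟩ := hM.vertex v hv
  refine ⟨e, ⟨mem_union_left _ he, hev⟩, fun e' ⟨he', hev'⟩ ↦ huniq e' ⟨?_, hev'⟩⟩
  rcases mem_union.1 he' with h | h
  · exact h
  have hout := hN.outside e' h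
  have hcut : e' ∈ edgeCut a b U := by
    simp only [mem_compl] at hout
    rw [mem_edgeCut_singleton] at hev'
    rw [mem_edgeCut]
    by_cases h1 : a e' = v
    · rw [h1] at hout ⊢; tauto
    · have h2 : b e' = v := by tauto
      rw [h2] at hout ⊢; tauto
  have := hN.cut.unique ⟨h, by rwa [edgeCut_compl]⟩ ⟨hfN, by rwa [edgeCut_compl]⟩
  exact this ▸ hfM

open scoped Classical in
theorem DominatedByPerfect.of_contract [Fintype V] (hx : OddCutFeasible a b x)
    (ht : ∑ e ∈ edgeCut a b U, x e = 1)
    (h₁ : DominatedByPerfect (contractMap U ∘ a) (contractMap U ∘ b) (contractWeight a b x U))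
    (h₂ : DominatedByPerfect (contractMap Uᶜ ∘ a) (contractMap Uᶜ ∘ b)
      (contractWeight a b x Uᶜ)) :
    DominatedByPerfect a b x := by
  intro s
  obtain ⟨N₁, hN₁, hs₁⟩ := exists_completion_cost (h₁.exists_outside hx) s
  obtain ⟨N₂, hN₂, hs₂⟩ := exists_completion_cost (h₂.exists_outside hx) s
  rw [edgeCut_compl] at hN₂ hs₂
  set C := edgeCut a b U with hC
  have hsplit : ∑ e ∈ C, s e * x e + (∑ e ∈ Cᶜ, s e * (if a e ∈ U ∧ b e ∈ U then 0 else x e) +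
      ∑ e ∈ Cᶜ, s e * (if a e ∈ Uᶜ ∧ b e ∈ Uᶜ then 0 else x e)) = ∑ e, s e * x e := by
    rw [← sum_add_distrib, ← sum_add_sum_compl C (fun e ↦ s e * x e)]
    congr 1
    refine sum_congr rfl fun e he ↦ ?_
    rw [mem_compl, hC, mem_edgeCut, not_not] at he
    simp only [mem_compl, he]
    by_cases h : b e ∈ U <;> simp [h]
  obtain ⟨f, hf, hfpos, hfs⟩ : ∃ f ∈ C, 0 < x f ∧
      ∑ e ∈ N₁ f \ C, s e + ∑ e ∈ N₂ f \ C, s e + s f ≤ ∑ e, s e * x e := by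
    by_contra! hcon
    have hle : ∑ f ∈ C, x f * (∑ e ∈ N₁ f \ C, s e + ∑ e ∈ N₂ f \ C, s e + s f) ≤
        ∑ f ∈ C, x f * ∑ e, s e * x e := by
      rw [← sum_mul, ht, one_mul, ← hsplit]
      simp_rw [mul_add, sum_add_distrib, mul_comm (x _) (s _)]
      linarith
    refine hle.not_gt (sum_lt_sum (fun f hf ↦ ?_) ?_)
    · rcases (hx.nonneg f).eq_or_lt with h0 | h0
      · simp [← h0]
      · exact mul_le_mul_of_nonneg_left (hcon f hf h0).le h0.le
    · by_contra! h
      have : ∑ e ∈ C, x e = 0 := sum_eq_zero fun f hf ↦ by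
        by_contra h0
        have h0 := lt_of_le_of_ne (hx.nonneg f) (Ne.symm h0)
        exact (h f hf).not_gt (mul_lt_mul_of_pos_left (hcon f hf h0) h0)
      linarith
  obtain ⟨hM₁, hf₁⟩ := hN₁ f hf hfpos
  obtain ⟨hM₂, hf₂⟩ := hN₂ f hf hfpos
  refine ⟨N₁ f ∪ N₂ f, fun e he ↦ ?_, fun v ↦ ?_, ?_⟩
  · rcases mem_union.1 he with h | h
    exacts [hM₁.pos e h, hM₂.pos e h]
  · by_cases hv : v ∈ U
    · rw [union_comm]
      have hM₁' : IsPerfectOutside a b x Uᶜᶜ (N₁ f) := by rwa [compl_compl]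
      exact hM₂.existsUnique_union hM₁' (by rwa [edgeCut_compl]) hf₂ hf₁ (by simpa using hv)
    · exact hM₁.existsUnique_union hM₂ hf hf₁ hf₂ hv
  · have hinter : (N₁ f ∪ N₂ f) ∩ C = {f} := by
      ext e
      simp only [mem_inter, mem_union, mem_singleton]
      constructor
      · rintro ⟨h | h, he⟩
        · exact hM₁.cut.unique ⟨h, he⟩ ⟨hf₁, hf⟩
        · exact hM₂.cut.unique ⟨h, by rwa [edgeCut_compl]⟩ ⟨hf₂, by rwa [edgeCut_compl]⟩
      · rintro rfl; exact ⟨.inl hf₁, hf⟩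
    rw [← sum_inter_add_sum_sdiff _ C, hinter, sum_singleton, union_sdiff_distrib, sum_union]
    · linarith
    · rw [disjoint_left]
      intro e he he'
      rw [mem_sdiff] at he he'
      have h1 := hM₁.outside e he.1
      have h2 := hM₂.outside e he'.1
      have h3 := he.2
      rw [hC, mem_edgeCut] at h3
      simp only [mem_compl] at h2
      tauto

end Contraction

section Edmonds

theorem exists_first_tight {ι : Type} (t : Finset ι) (α β : ι → ℝ) (hα : ∀ i ∈ t, 0 < α i)
    (hβ : ∃ i ∈ t, β i < 0) :
    ∃ ε > 0, (∀ i ∈ t, 0 ≤ α i + ε * β i) ∧ ∃ i ∈ t, α i + ε * β i = 0 := by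
  classical
  obtain ⟨i₀, hi₀, hmin⟩ := exists_min_image {i ∈ t | β i < 0} (fun i ↦ α i / -β i)
    (by obtain ⟨i, hi, h⟩ := hβ; exact ⟨i, by simp [hi, h]⟩)
  obtain ⟨hi₀t, hi₀β⟩ := mem_filter.1 hi₀
  have hε : 0 < α i₀ / -β i₀ := div_pos (hα _ hi₀t) (neg_pos.2 hi₀β)
  refine ⟨_, hε, fun i hi ↦ ?_, i₀, hi₀t, by field_simp [hi₀β.ne]; ring⟩
  by_cases h : β i < 0
  · have := (le_div_iff₀ (neg_pos.2 h)).1 (hmin i (by simp [hi, h]))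
    linarith
  · exact add_nonneg (hα i hi).le (mul_nonneg hε.le (not_lt.1 h))

variable {V E : Type} [Fintype E] {a b : E → V} {x : E → ℝ}

theorem OddCutFeasible.le_one (hx : OddCutFeasible a b x) (e : E) : x e ≤ 1 := by
  rcases (hx.nonneg e).eq_or_lt with h | h
  · linarith
  rw [← hx.degree (a e)]
  refine single_le_sum (f := x) (fun f _ ↦ hx.nonneg f) ?_
  have := hx.ne_of_pos h
  rw [mem_edgeCut_singleton]
  tauto

theorem OddCutFeasible.even_card [Fintype V] (hx : OddCutFeasible a b x) :
    Even (Fintype.card V) := by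
  by_contra h
  have h1 := hx.odd univ (by simpa using h)
  have : edgeCut a b (univ : Finset V) = ∅ := by ext e; simp [mem_edgeCut]
  rw [this, sum_empty] at h1
  linarith

open scoped Classical in
theorem IsPerfectEdgeSet.sum_indicator {M : Finset E} (hM : IsPerfectEdgeSet a b M) (v : V) :
    ∑ e ∈ edgeCut a b {v}, (if e ∈ M then (1 : ℝ) else 0) = 1 := by
  obtain ⟨e, he, huniq⟩ := hM v
  rw [sum_eq_single_of_mem e he.2]
  · simp [he.1]
  · intro f hf hfe
    exact if_neg fun h ↦ hfe (huniq f ⟨h, hf⟩)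

open scoped Classical in
/-- Moving away from a perfect edge set until an inequality becomes tight. -/
theorem OddCutFeasible.exists_step [Fintype V] (hx : OddCutFeasible a b x)
    (hnt : ∀ U : Finset V, Odd #U → 2 ≤ #U → 2 ≤ #Uᶜ → ∑ e ∈ edgeCut a b U, x e ≠ 1)
    {M : Finset E} (hpos : ∀ e ∈ M, 0 < x e) (hM : IsPerfectEdgeSet a b M)
    (hlt : ∃ e ∈ M, x e < 1) :
    ∃ ε > 0, OddCutFeasible a b (fun e ↦ x e + ε * (x e - if e ∈ M then 1 else 0)) ∧
      ((∃ e ∈ M, x e + ε * (x e - if e ∈ M then 1 else 0) = 0) ∨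
        ∃ U : Finset V, Odd #U ∧ 2 ≤ #U ∧ 2 ≤ #Uᶜ ∧
          ∑ e ∈ edgeCut a b U, (x e + ε * (x e - if e ∈ M then 1 else 0)) = 1) := by
  let t : Finset (E ⊕ Finset V) := M.disjSum {U | Odd #U ∧ 2 ≤ #U ∧ 2 ≤ #Uᶜ}
  obtain ⟨ε, hε, hge, hzero⟩ := exists_first_tight t
    (Sum.elim x fun U ↦ ∑ e ∈ edgeCut a b U, x e - 1)
    (Sum.elim (fun e ↦ x e - if e ∈ M then 1 else 0)
      fun U ↦ ∑ e ∈ edgeCut a b U, (x e - if e ∈ M then 1 else 0)) (by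
    rintro (e | U) h
    · exact hpos e (by simpa [t] using h)
    · obtain ⟨h1, h2, h3⟩ : Odd #U ∧ 2 ≤ #U ∧ 2 ≤ #Uᶜ := by simpa [t] using h
      exact sub_pos.2 (lt_of_le_of_ne (hx.odd U h1) (hnt U h1 h2 h3).symm)) (by
    obtain ⟨e, he, h⟩ := hlt
    exact ⟨.inl e, by simpa [t] using he, by simpa [he] using h⟩)
  have hsum : ∀ U : Finset V, ∑ e ∈ edgeCut a b U, (x e + ε * (x e - if e ∈ M then 1 else 0)) =
      ∑ e ∈ edgeCut a b U, x e + ε * ∑ e ∈ edgeCut a b U, (x e - if e ∈ M then 1 else 0) := by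
    intro U; rw [sum_add_distrib, mul_sum]
  have hdeg : ∀ v, ∑ e ∈ edgeCut a b {v}, (x e + ε * (x e - if e ∈ M then 1 else 0)) = 1 := by
    intro v
    rw [hsum, sum_sub_distrib, hM.sum_indicator, hx.degree]; ring
  refine ⟨ε, hε, ⟨fun e ↦ ?_, fun e he ↦ ?_, hdeg, fun U hU ↦ ?_⟩, ?_⟩
  · by_cases he : e ∈ M
    · simpa using hge (.inl e) (by simpa [t] using he)
    · have := hx.nonneg e
      simp only [he, if_false, sub_zero]
      positivity
  · have h0 := hx.loop e he
    have : e ∉ M := fun h ↦ (hpos e h).ne' h0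
    simp [this, h0]
  · by_cases h1 : #U < 2
    · obtain ⟨v, rfl⟩ := card_eq_one.1 (by have := hU.pos; omega : #U = 1)
      exact (hdeg v).ge
    by_cases h2 : #Uᶜ < 2
    · have hcard := card_add_card_compl U
      have hodd : Odd #Uᶜ := by
        have := hx.even_card
        rw [← hcard, Nat.even_add] at this
        rw [← Nat.not_even_iff_odd] at hU ⊢
        tauto
      obtain ⟨v, hv⟩ := card_eq_one.1 (by have := hodd.pos; omega : #Uᶜ = 1)
      rw [← edgeCut_compl, hv]
      exact (hdeg v).ge
    · rw [hsum]
      have := hge (.inr U) (by simp only [t, inr_mem_disjSum, mem_filter, mem_univ, true_and]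
                               exact ⟨hU, by omega, by omega⟩)
      simp only [Sum.elim_inr] at this
      linarith
  · obtain ⟨e | U, h, hz⟩ := hzero
    · exact .inl ⟨e, by simpa [t] using h, by simpa using hz⟩
    · obtain ⟨h1, h2, h3⟩ : Odd #U ∧ 2 ≤ #U ∧ 2 ≤ #Uᶜ := by simpa [t] using h
      refine .inr ⟨U, h1, h2, h3, ?_⟩
      rw [hsum]
      simp only [Sum.elim_inr] at hz
      linarith

theorem OddCutFeasible.eq_indicator (hx : OddCutFeasible a b x)
    {M : Finset E} (hM : IsPerfectEdgeSet a b M) (h1 : ∀ e ∈ M, x e = 1) {e : E} (he : e ∉ M) :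
    x e = 0 := by
  classical
  by_contra h0
  have hpos := lt_of_le_of_ne (hx.nonneg e) (Ne.symm h0)
  obtain ⟨f, ⟨hfM, hf⟩, -⟩ := hM (a e)
  have hef : e ≠ f := fun h ↦ he (h ▸ hfM)
  have heC : e ∈ edgeCut a b {a e} := by
    have := hx.ne_of_pos hpos
    rw [mem_edgeCut_singleton]; tauto
  have h2 : ∑ g ∈ {e, f}, x g ≤ ∑ g ∈ edgeCut a b {a e}, x g :=
    sum_le_sum_of_subset_of_nonneg (by simp [insert_subset_iff, heC, hf])
      fun g _ _ ↦ hx.nonneg g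
  rw [sum_pair hef, hx.degree, h1 f hfM] at h2
  linarith

/-- Edmonds' description of the perfect matching polytope, in dual form. -/
theorem OddCutFeasible.dominatedByPerfect [Fintype V] (hx : OddCutFeasible a b x) :
    DominatedByPerfect a b x := by
  classical
  induction hn : Fintype.card V using Nat.strong_induction_on generalizing V x with
  | _ n ihV =>
  subst hn
  have tight : ∀ y : E → ℝ, OddCutFeasible a b y → ∀ U : Finset V, Odd #U → 2 ≤ #U → 2 ≤ #Uᶜ →
      ∑ e ∈ edgeCut a b U, y e = 1 → DominatedByPerfect a b y := by
    intro y hy U hU h2 h2' ht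
    have hcard := card_add_card_compl U
    have hodd : Odd #Uᶜ := by
      have := hy.even_card
      rw [← hcard, Nat.even_add] at this
      rw [← Nat.not_even_iff_odd] at hU ⊢
      tauto
    have key : ∀ W : Finset V, Odd #W → 2 ≤ #W → ∑ e ∈ edgeCut a b W, y e = 1 →
        DominatedByPerfect (contractMap W ∘ a) (contractMap W ∘ b) (contractWeight a b y W) := by
      intro W hW hW2 hWt
      refine ihV _ ?_ (hy.contract hW hWt) rfl
      have := card_add_card_compl W
      have hsub : Fintype.card {v // v ∉ W} = #Wᶜ := by
        rw [Fintype.card_subtype]; congr 1; ext; simp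
      rw [Fintype.card_option, hsub]
      omega
    exact DominatedByPerfect.of_contract hy ht (key U hU h2 ht)
      (key Uᶜ hodd h2' (by rwa [edgeCut_compl]))
  induction hk : #{e | 0 < x e} using Nat.strong_induction_on generalizing x with
  | _ k ih =>
  subst hk
  by_cases hnt : ∀ U : Finset V, Odd #U → 2 ≤ #U → 2 ≤ #Uᶜ → ∑ e ∈ edgeCut a b U, x e ≠ 1
  swap
  · push Not at hnt
    obtain ⟨U, h1, h2, h3, h4⟩ := hnt
    exact tight x hx U h1 h2 h3 h4
  intro s
  obtain ⟨M, hpos, hM⟩ := hx.exists_perfect_support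
  by_cases hs : ∑ e ∈ M, s e ≤ ∑ e, s e * x e
  · exact ⟨M, hpos, hM, hs⟩
  have hlt : ∃ e ∈ M, x e < 1 := by
    by_contra! h
    have h1 : ∀ e ∈ M, x e = 1 := fun e he ↦ le_antisymm (hx.le_one e) (h e he)
    refine hs (le_of_eq ?_)
    rw [← sum_subset (subset_univ M) (fun e _ he ↦ by rw [hx.eq_indicator hM h1 he, mul_zero])]
    exact sum_congr rfl fun e he ↦ by rw [h1 e he, mul_one]
  obtain ⟨ε, hε, hy, hor⟩ := hx.exists_step hnt hpos hM hlt
  set y : E → ℝ := fun e ↦ x e + ε * (x e - if e ∈ M then 1 else 0) with hydef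
  have hsub : ∀ e, 0 < y e → 0 < x e := by
    intro e he
    by_contra h0
    have h0 : x e = 0 := le_antisymm (not_lt.1 h0) (hx.nonneg e)
    have : e ∉ M := fun h ↦ (hpos e h).ne' h0
    simp [y, h0, this] at he
  have hdom : DominatedByPerfect a b y := by
    rcases hor with ⟨e, heM, he⟩ | ⟨U, h1, h2, h3, h4⟩
    · refine ih _ (card_lt_card ⟨fun f hf ↦ by simpa using hsub f (by simpa using hf), ?_⟩) hy rfl
      intro hss
      have h5 : e ∈ ({e | 0 < y e} : Finset E) := hss (by simpa using hpos e heM)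
      exact (mem_filter.1 h5).2.ne' he
    · exact tight y hy U h1 h2 h3 h4
  obtain ⟨N, hNpos, hN, hNs⟩ := hdom s
  refine ⟨N, fun e he ↦ hsub e (hNpos e he), hN, hNs.trans ?_⟩
  have : ∑ e, s e * y e = ∑ e, s e * x e + ε * (∑ e, s e * x e - ∑ e ∈ M, s e) := by
    have hMs : ∑ e ∈ M, s e = ∑ e, s e * (if e ∈ M then 1 else 0) := by simp
    rw [hMs, ← sum_sub_distrib, mul_sum, ← sum_add_distrib]
    exact sum_congr rfl fun e _ ↦ by ring
  nlinarith

end Edmonds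

section Sampling

variable {V E : Type} [Fintype E] {a b : E → V} {x : E → ℝ}

open scoped Classical in
theorem OddCutFeasible.exists_approximation [Fintype V] (hx : OddCutFeasible a b x) (k : ℕ) :
    ∃ T : Fin k → Finset E, (∀ i, IsPerfectEdgeSet a b (T i)) ∧
      ∑ e, (∑ i, ((if e ∈ T i then 1 else 0) - x e)) ^ 2 ≤ (k : ℝ) * Fintype.card E := by
  induction k with
  | zero => exact ⟨Fin.elim0, fun i ↦ i.elim0, by simp⟩
  | succ k ih =>
    obtain ⟨T, hT, hsum⟩ := ih
    set S : E → ℝ := fun e ↦ ∑ i, ((if e ∈ T i then 1 else 0) - x e) with hS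
    obtain ⟨M, -, hM, hs⟩ := hx.dominatedByPerfect S
    refine ⟨Fin.cons M T, Fin.cases hM hT, ?_⟩
    simp only [Fin.sum_univ_succ, Fin.cons_zero, Fin.cons_succ]
    have hM' : ∑ e ∈ M, S e = ∑ e, S e * (if e ∈ M then 1 else 0) := by simp
    have hle : ∀ e, ((if e ∈ M then (1 : ℝ) else 0) - x e + S e) ^ 2 ≤
        S e ^ 2 + 2 * (S e * (if e ∈ M then 1 else 0) - S e * x e) + 1 := by
      intro e
      have h0 := hx.nonneg e
      have h1 := hx.le_one e
      split_ifs <;> nlinarith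
    refine (sum_le_sum fun e _ ↦ hle e).trans ?_
    rw [sum_add_distrib, sum_add_distrib, ← mul_sum, sum_sub_distrib, ← hM']
    simp only [sum_const, card_univ, nsmul_eq_mul, mul_one]
    push_cast
    linarith

end Sampling

section Counting

theorem card_hammingBall_pow_mul_le {E : Type} [Fintype E] [DecidableEq E] {q K L : ℕ}
    (hq : 0 < q) (hL : 0 < L) (f : E → Fin (K + 1)) :
    #{g : E → Fin (K + 1) | q * #{e | f e ≠ g e} ≤ Fintype.card E} ^ q *
      L ^ (q * Fintype.card E) ≤ ((L + K) ^ q * L) ^ Fintype.card E := by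
  set m := Fintype.card E with hm
  set S : Finset (E → Fin (K + 1)) := {g | q * #{e | f e ≠ g e} ≤ m} with hS
  have htotal : ∑ g : E → Fin (K + 1), ∏ e, (if f e = g e then L else 1) = (L + K) ^ m := by
    rw [← Fintype.prod_sum (fun e j ↦ if f e = j then L else 1)]
    have : ∀ e, ∑ j : Fin (K + 1), (if f e = j then L else 1) = L + K := by
      intro e
      rw [← add_sum_erase _ _ (mem_univ (f e)), if_pos rfl]
      rw [sum_congr rfl fun j hj ↦ if_neg (ne_of_mem_erase hj).symm]
      simp
    simp [this, hm]
  have hprod : ∀ g : E → Fin (K + 1), (∏ e, (if f e = g e then L else 1)) *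
      L ^ #{e | f e ≠ g e} = L ^ m := by
    intro g
    rw [prod_ite, prod_const, prod_const_one, mul_one, ← pow_add, hm]
    congr 1
    exact card_filter_add_card_filter_not _
  have hball : #S * L ^ m ≤ (L + K) ^ m * L ^ (m / q) := by
    rw [← htotal, sum_mul, ← smul_eq_mul, ← sum_const]
    refine (sum_le_sum fun g hg ↦ ?_).trans (sum_le_sum_of_subset (subset_univ S))
    rw [← hprod g]
    refine Nat.mul_le_mul_left _ (Nat.pow_le_pow_right hL ?_)
    rw [Nat.le_div_iff_mul_le hq, mul_comm]
    exact (mem_filter.1 hg).2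
  calc #S ^ q * L ^ (q * m) = (#S * L ^ m) ^ q := by rw [mul_pow, ← pow_mul, mul_comm m q]
    _ ≤ ((L + K) ^ m * L ^ (m / q)) ^ q := Nat.pow_le_pow_left hball q
    _ = ((L + K) ^ q) ^ m * L ^ (m / q * q) := by
      rw [mul_pow, ← pow_mul, ← pow_mul, ← pow_mul, mul_comm m q]
    _ ≤ ((L + K) ^ q) ^ m * L ^ m :=
      Nat.mul_le_mul_left _ (Nat.pow_le_pow_right hL (Nat.div_mul_le_self m q))
    _ = _ := (mul_pow _ _ _).symm

theorem exists_card_le_mul_card_fiber {α β : Type} [Fintype α] [Fintype β] [Nonempty β]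
    [DecidableEq β] (A : α → β) :
    ∃ y, Fintype.card α ≤ Fintype.card β * #{z | A z = y} := by
  obtain ⟨y, -, hy⟩ := exists_max_image univ (fun y ↦ #{z | A z = y}) univ_nonempty
  refine ⟨y, ?_⟩
  rw [mul_comm]
  exact card_le_mul_card_image_of_maps_to (s := univ) (t := univ) (f := A) (by simp) _ hy

variable {V E : Type} [Fintype E] {a b : E → V}

open scoped Classical in
theorem sum_card_edgeCut (hloop : ∀ e, a e ≠ b e) (U : Finset V) :
    ∑ v ∈ U, #(edgeCut a b {v}) =
      ∑ e, ((if a e ∈ U then 1 else 0) + if b e ∈ U then 1 else 0) := by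
  have h : ∀ v, #(edgeCut a b {v}) =
      ∑ e, ((if a e = v then 1 else 0) + if b e = v then 1 else 0) := by
    intro v
    rw [edgeCut, card_filter]
    refine sum_congr rfl fun e _ ↦ ?_
    have := hloop e
    by_cases h1 : a e = v <;> by_cases h2 : b e = v <;> simp [h1, h2]
    exact this (h1.trans h2.symm)
  simp_rw [h]
  rw [sum_comm]
  refine sum_congr rfl fun e _ ↦ ?_
  rw [sum_add_distrib, sum_ite_eq, sum_ite_eq]

theorem odd_card_edgeCut (hloop : ∀ e, a e ≠ b e) (hdeg : ∀ v, #(edgeCut a b {v}) = 3)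
    {U : Finset V} (hU : Odd #U) : Odd #(edgeCut a b U) := by
  classical
  have h := sum_card_edgeCut hloop U
  simp only [hdeg, sum_const, smul_eq_mul] at h
  have h1 : Odd (#U * 3) := hU.mul (by decide)
  rw [h, odd_sum_iff_odd_card_odd] at h1
  convert h1 using 2
  ext e
  by_cases h1 : a e ∈ U <;> by_cases h2 : b e ∈ U <;> simp [mem_edgeCut, h1, h2]

theorem two_mul_card_edges [Fintype V] (hloop : ∀ e, a e ≠ b e) (hdeg : ∀ v, #(edgeCut a b {v}) = 3) :
    2 * Fintype.card E = 3 * Fintype.card V := by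
  have h := sum_card_edgeCut hloop univ
  simp [hdeg] at h
  omega

theorem oddCutFeasible_of_one_fifth_le [Fintype V] (hloop : ∀ e, a e ≠ b e)
    (hdeg : ∀ v, #(edgeCut a b {v}) = 3)
    (hcut : ∀ U : Finset V, 2 ≤ #U → #U + 2 ≤ Fintype.card V → 4 ≤ #(edgeCut a b U))
    {x : E → ℝ} (hx : ∀ e, 1 / 5 ≤ x e) (hsum : ∀ v, ∑ e ∈ edgeCut a b {v}, x e = 1) :
    OddCutFeasible a b x := by
  classical
  refine ⟨fun e ↦ by linarith [hx e], fun e h ↦ absurd h (hloop e), hsum, fun U hU ↦ ?_⟩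
  have heven := two_mul_card_edges hloop hdeg
  have hcard := card_add_card_compl U
  obtain ⟨k, hk⟩ := hU
  by_cases h1 : #U < 2
  · obtain ⟨v, rfl⟩ := card_eq_one.1 (by omega : #U = 1)
    exact (hsum v).ge
  by_cases h2 : #Uᶜ < 2
  · obtain ⟨v, hv⟩ := card_eq_one.1 (by omega : #Uᶜ = 1)
    rw [← edgeCut_compl, hv]
    exact (hsum v).ge
  have h4 := hcut U (by omega) (by omega)
  obtain ⟨j, hj⟩ := odd_card_edgeCut hloop hdeg ⟨k, hk⟩
  have h5 : (5 : ℝ) ≤ #(edgeCut a b U) := by exact_mod_cast (by omega : 5 ≤ #(edgeCut a b U))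
  calc (1 : ℝ) ≤ #(edgeCut a b U) • (1 / 5 : ℝ) := by rw [nsmul_eq_mul]; linarith
    _ ≤ _ := card_nsmul_le_sum _ _ _ fun e _ ↦ hx e

open scoped Classical in
theorem card_ne_mul_le_of_common_approximation {k : ℕ} {f g : E → Fin 16} {x y : E → ℝ}
    (hk : k = 225 ^ 2 * 64)
    (hxy : ∀ e, x e - y e = ((f e : ℝ) - (g e : ℝ)) * (2 / 225)) (T : Fin k → Finset E)
    (hx : ∑ e, (∑ i, ((if e ∈ T i then 1 else 0) - x e)) ^ 2 ≤ (k : ℝ) * Fintype.card E)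
    (hy : ∑ e, (∑ i, ((if e ∈ T i then 1 else 0) - y e)) ^ 2 ≤ (k : ℝ) * Fintype.card E) :
    64 * #{e | f e ≠ g e} ≤ Fintype.card E := by
  have hkR : (k : ℝ) = 225 ^ 2 * 64 := by exact_mod_cast hk
  have hpt : ∀ e, (k * (2 / 225) : ℝ) ^ 2 * (if f e ≠ g e then 1 else 0) ≤
      2 * (∑ i, ((if e ∈ T i then 1 else 0) - x e)) ^ 2 +
        2 * (∑ i, ((if e ∈ T i then 1 else 0) - y e)) ^ 2 := by
    intro e
    have hdiff : (∑ i, ((if e ∈ T i then 1 else 0) - y e)) -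
        (∑ i, ((if e ∈ T i then 1 else 0) - x e)) =
          k * (2 / 225) * ((f e : ℝ) - (g e : ℝ)) := by
      rw [← sum_sub_distrib]
      simp only [sub_sub_sub_cancel_left, hxy]
      simp
      ring
    have hsq : (if f e ≠ g e then (1 : ℝ) else 0) ≤ ((f e : ℝ) - (g e : ℝ)) ^ 2 := by
      split_ifs with h
      · have h1 : ((f e : ℕ) : ℤ) - (g e : ℕ) ≠ 0 := by
          rw [sub_ne_zero]; exact_mod_cast fun h' ↦ h (Fin.ext h')
        have h2 : (1 : ℤ) ≤ (((f e : ℕ) : ℤ) - (g e : ℕ)) ^ 2 := by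
          have := sq_pos_of_ne_zero h1
          omega
        exact_mod_cast h2
      · positivity
    calc _ ≤ (k * (2 / 225) : ℝ) ^ 2 * ((f e : ℝ) - (g e : ℝ)) ^ 2 :=
          mul_le_mul_of_nonneg_left hsq (sq_nonneg _)
      _ = _ := by rw [← mul_pow, ← hdiff]
      _ ≤ _ := by
        set u := ∑ i, ((if e ∈ T i then 1 else 0) - x e)
        set v := ∑ i, ((if e ∈ T i then 1 else 0) - y e)
        nlinarith [sq_nonneg (u + v)]
  have hsum := sum_le_sum fun e (_ : e ∈ univ) ↦ hpt e
  rw [← mul_sum, sum_add_distrib, ← mul_sum, ← mul_sum, sum_boole] at hsum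
  have hfin : (64 * #{e | f e ≠ g e} : ℝ) ≤ Fintype.card E := by
    rw [hkR] at hsum hx hy
    norm_num at hsum hx hy ⊢
    linarith
  exact_mod_cast hfin

open scoped Classical in
theorem two_pow_le_card_perfect_pow [Fintype V] (hloop : ∀ e, a e ≠ b e)
    (hdeg : ∀ v, #(edgeCut a b {v}) = 3)
    (hcut : ∀ U : Finset V, 2 ≤ #U → #U + 2 ≤ Fintype.card V → 4 ≤ #(edgeCut a b U))
    {k : ℕ} (hk : k = 225 ^ 2 * 64) :
    ∃ h, Fintype.card V = 2 * h ∧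
      2 ^ h ≤ #{M : Finset E | IsPerfectEdgeSet a b M} ^ (64 * k) := by
  have hedges := two_mul_card_edges hloop hdeg
  obtain ⟨h, hV⟩ : ∃ h, Fintype.card V = 2 * h := ⟨Fintype.card V / 2, by omega⟩
  have hE : Fintype.card E = 3 * h := by omega
  refine ⟨h, hV, ?_⟩
  set N := #{M : Finset E | IsPerfectEdgeSet a b M} with hN
  have hle : ∀ (f : E → Fin 16) v, ∑ e ∈ edgeCut a b {v}, (f e : ℕ) < 46 := by
    intro f v
    have := sum_le_card_nsmul (edgeCut a b {v}) (fun e ↦ (f e : ℕ)) 15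
      fun e _ ↦ Nat.lt_succ_iff.1 (f e).2
    rw [hdeg] at this
    simp only [smul_eq_mul] at this
    omega
  obtain ⟨y, hy⟩ := exists_card_le_mul_card_fiber
    (fun (f : E → Fin 16) (v : V) ↦ (⟨∑ e ∈ edgeCut a b {v}, (f e : ℕ), hle f v⟩ : Fin 46))
  set F : Finset (E → Fin 16) :=
    {f | (fun v ↦ (⟨∑ e ∈ edgeCut a b {v}, (f e : ℕ), hle f v⟩ : Fin 46)) = y} with hF
  simp only [Fintype.card_fun, Fintype.card_fin, hE, hV] at hy
  obtain ⟨f₀, hf₀⟩ : F.Nonempty := by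
    rw [nonempty_iff_ne_empty]
    intro h0
    rw [h0, card_empty, mul_zero] at hy
    exact absurd hy (by simp)
  have hFsum : ∀ f ∈ F, ∀ v, ∑ e ∈ edgeCut a b {v}, (f e : ℕ) = (y v : ℕ) := by
    intro f hf v
    rw [← (mem_filter.1 hf).2]
  let x : (E → Fin 16) → E → ℝ := fun f e ↦ 1 / 3 + ((f e : ℝ) - (f₀ e : ℝ)) * (2 / 225)
  have hx : ∀ f ∈ F, OddCutFeasible a b (x f) := by
    intro f hf
    refine oddCutFeasible_of_one_fifth_le hloop hdeg hcut (fun e ↦ ?_) fun v ↦ ?_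
    · have h1 : ((f₀ e : ℕ) : ℝ) ≤ 15 := by exact_mod_cast Nat.lt_succ_iff.1 (f₀ e).2
      have h2 : (0 : ℝ) ≤ ((f e : ℕ) : ℝ) := Nat.cast_nonneg _
      simp only [x]
      linarith
    · have h1 : ∑ e ∈ edgeCut a b {v}, ((f e : ℕ) : ℝ) = (y v : ℕ) := by
        exact_mod_cast hFsum f hf v
      have h2 : ∑ e ∈ edgeCut a b {v}, ((f₀ e : ℕ) : ℝ) = (y v : ℕ) := by
        exact_mod_cast hFsum f₀ hf₀ v
      simp only [x]
      rw [sum_add_distrib, ← sum_mul, sum_sub_distrib, h1, h2, sum_const, hdeg]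
      norm_num
  have happrox : ∀ f, ∃ T : Fin k → Finset E, f ∈ F → (∀ i, IsPerfectEdgeSet a b (T i)) ∧
      ∑ e, (∑ i, ((if e ∈ T i then 1 else 0) - x f e)) ^ 2 ≤ (k : ℝ) * Fintype.card E := by
    intro f
    by_cases hf : f ∈ F
    · obtain ⟨T, hT⟩ := (hx f hf).exists_approximation k
      exact ⟨T, fun _ ↦ hT⟩
    · exact ⟨fun _ ↦ ∅, fun h ↦ absurd h hf⟩
  choose T hT using happrox
  let ball : (E → Fin 16) → Finset (E → Fin 16) := fun f ↦
    {g | 64 * #{e | f e ≠ g e} ≤ Fintype.card E}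
  obtain ⟨f₁, -, hmax⟩ := exists_max_image univ (fun f ↦ #(ball f)) ⟨f₀, mem_univ _⟩
  have hFcard : #F ≤ #(ball f₁) * N ^ k := by
    have hpi : #(Fintype.piFinset fun _ : Fin k ↦
        ({M : Finset E | IsPerfectEdgeSet a b M} : Finset (Finset E))) = N ^ k := by
      simp [hN]
    rw [← hpi]
    refine card_le_mul_card_image_of_maps_to (f := T) (fun f hf ↦ ?_) _ fun t _ ↦ ?_
    · simpa using (hT f hf).1
    · obtain he | ⟨f, hf⟩ := ({f ∈ F | T f = t} : Finset _).eq_empty_or_nonempty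
      · rw [he]; simp
      refine le_trans (card_le_card fun g hg ↦ ?_) (hmax f (mem_univ f))
      obtain ⟨hf, hft⟩ := mem_filter.1 hf
      obtain ⟨hg, hgt⟩ := mem_filter.1 hg
      have hTg := (hT g hg).2
      rw [hgt, ← hft] at hTg
      refine mem_filter.2 ⟨mem_univ g, card_ne_mul_le_of_common_approximation hk (fun e ↦ ?_) (T f)
        (hT f hf).2 hTg⟩
      simp only [x]
      ring
  have hball := card_hammingBall_pow_mul_le (q := 64) (K := 15) (L := 960) (by simp) (by simp) f₁
  change #(ball f₁) ^ 64 * _ ≤ _ at hball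
  rw [hE] at hball
  have hmain : (2 * (46 ^ 128 * (975 ^ 64 * 960) ^ 3)) ^ h ≤
      (46 ^ 128 * (975 ^ 64 * 960) ^ 3) ^ h * N ^ (64 * k) := by
    calc (2 * (46 ^ 128 * (975 ^ 64 * 960) ^ 3)) ^ h ≤ ((16 ^ 3) ^ 64 * 960 ^ (64 * 3)) ^ h :=
          Nat.pow_le_pow_left (by norm_num) h
      _ = (16 ^ (3 * h)) ^ 64 * 960 ^ (64 * (3 * h)) := by
        rw [mul_pow, ← pow_mul, ← pow_mul, ← pow_mul, ← pow_mul]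
        ring_nf
      _ ≤ (46 ^ (2 * h) * (#(ball f₁) * N ^ k)) ^ 64 * 960 ^ (64 * (3 * h)) :=
        Nat.mul_le_mul_right _
          (Nat.pow_le_pow_left (hy.trans (Nat.mul_le_mul_left _ hFcard)) 64)
      _ = (46 ^ (2 * h)) ^ 64 * N ^ (64 * k) *
          (#(ball f₁) ^ 64 * 960 ^ (64 * (3 * h))) := by
        rw [mul_pow, mul_pow, ← pow_mul N, mul_comm k 64]
        generalize (46 ^ (2 * h)) ^ 64 = p, N ^ (64 * k) = r, 960 ^ (64 * (3 * h)) = t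
        ring
      _ ≤ (46 ^ (2 * h)) ^ 64 * N ^ (64 * k) * ((960 + 15) ^ 64 * 960) ^ (3 * h) :=
        Nat.mul_le_mul_left _ hball
      _ = _ := by
        rw [mul_pow (46 ^ 128), ← pow_mul, ← pow_mul, ← pow_mul,
          show 2 * h * 64 = 128 * h by ring]
        ac_rfl
  rw [mul_pow, mul_comm] at hmain
  exact Nat.le_of_mul_le_mul_left hmain (by positivity)

end Counting

section Graph

variable {V : Type} [Fintype V] {G : SimpleGraph V}

open scoped Classical in
theorem card_perfectEdgeSets_le_ncard {a b : G.edgeSet → V} (hab : ∀ e, s(a e, b e) = e.1) :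
    #{M : Finset G.edgeSet | IsPerfectEdgeSet a b M} ≤
      ({M : G.Subgraph | M.IsPerfectMatching}).ncard := by
  have hmem : ∀ v e, e ∈ edgeCut a b {v} ↔ v ∈ e.1 := by
    intro v e
    have hne : a e ≠ b e := SimpleGraph.Adj.ne (G := G) (by
      rw [← SimpleGraph.mem_edgeSet, hab]; exact e.2)
    rw [mem_edgeCut_singleton, ← hab, Sym2.mem_iff]
    constructor
    · intro h
      by_cases h1 : a e = v
      · exact .inl h1.symm
      · exact .inr (by tauto)
    · rintro (rfl | rfl) <;> tauto
  let φ : Finset G.edgeSet → G.Subgraph := fun M ↦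
    { verts := Set.univ
      Adj := fun u v ↦ ∃ h : s(u, v) ∈ G.edgeSet, ⟨s(u, v), h⟩ ∈ M
      adj_sub := fun ⟨h, _⟩ ↦ h
      edge_vert := fun _ ↦ Set.mem_univ _
      symm := ⟨fun u v ⟨h, h'⟩ ↦ by
        have h1 : s(u, v) = s(v, u) := Sym2.eq_swap
        rw [← h1] at *
        exact ⟨h, h'⟩⟩ }
  rw [← Set.ncard_coe_finset]
  refine Set.ncard_le_ncard_of_injOn φ (fun M hM ↦ ?_) (fun M _ N _ h ↦ ?_) (Set.toFinite _)
  · have hM : IsPerfectEdgeSet a b M := by simpa using hM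
    rw [Set.mem_ofPred_eq, SimpleGraph.Subgraph.isPerfectMatching_iff]
    intro v
    obtain ⟨e, ⟨heM, he⟩, huniq⟩ := hM v
    obtain ⟨w, hw⟩ := Sym2.mem_iff_exists.1 ((hmem v e).1 he)
    have hwe : s(v, w) ∈ G.edgeSet := hw ▸ e.2
    have heq : e = ⟨s(v, w), hwe⟩ := Subtype.ext hw
    refine ⟨w, ⟨hwe, heq ▸ heM⟩, fun w' ⟨h, h'⟩ ↦ ?_⟩
    have h1 := huniq ⟨s(v, w'), h⟩ ⟨h', (hmem _ _).2 (Sym2.mem_mk_left v w')⟩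
    rw [heq, Subtype.mk.injEq] at h1
    exact Sym2.congr_right.1 h1
  · ext ⟨e, he⟩
    induction e using Sym2.ind with
    | _ u v =>
      have h1 : (φ M).Adj u v ↔ (φ N).Adj u v := by rw [h]
      simpa [φ, show G.Adj u v from he] using h1

theorem rpow_le_of_pow_le {N h n k : ℕ} (hk : 0 < k) (hn : n = 2 * h) (hN : 2 ^ h ≤ N ^ k) :
    (2 : ℝ) ^ (1 / (2 * k : ℝ) * n) ≤ N := by
  refine le_of_pow_le_pow_left₀ hk.ne' (Nat.cast_nonneg N) ?_
  have hkR : (k : ℝ) ≠ 0 := by exact_mod_cast hk.ne'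
  rw [← Real.rpow_natCast, ← Real.rpow_mul zero_le_two,
    show 1 / (2 * k : ℝ) * n * k = (h : ℕ) by rw [hn]; push_cast; field_simp, Real.rpow_natCast]
  exact_mod_cast hN

end Graph

/-- There is `γ > 0` such that every cubic (3-regular) graph `G` on a finite vertex set `V`,
all of whose cuts `δ(U)` with `2 ≤ |U| ≤ |V| - 2` have at least `4` edges, has at least
`2^{γ|V|}` distinct perfect matchings. -/
theorem stmt_5 :
    ∃ γ > (0 : ℝ), ∀ (V : Type) [Fintype V] (G : SimpleGraph V),
      (∀ v : V, (G.neighborSet v).ncard = 3) →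
      (∀ U : Finset V, 2 ≤ U.card → U.card ≤ Fintype.card V - 2 →
        4 ≤ ({e ∈ G.edgeSet | ∃ v w : V, e = s(v, w) ∧ v ∈ U ∧ w ∉ U}).ncard) →
      (2 : ℝ) ^ (γ * Fintype.card V) ≤
        (({M : G.Subgraph | M.IsPerfectMatching}).ncard : ℝ) := by
  classical
  obtain ⟨k, hk⟩ : ∃ k : ℕ, k = 225 ^ 2 * 64 := ⟨_, rfl⟩
  have hk0 : 0 < 64 * k := by rw [hk]; norm_num
  refine ⟨1 / (2 * (64 * k : ℕ) : ℝ), by positivity, fun V _ G hreg hcut ↦ ?_⟩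
  have hends : ∀ e : G.edgeSet, ∃ p : V × V, s(p.1, p.2) = e.1 := by
    rintro ⟨e, he⟩
    induction e using Sym2.ind with
    | _ u v => exact ⟨(u, v), rfl⟩
  choose p hp using hends
  let a : G.edgeSet → V := fun e ↦ (p e).1
  let b : G.edgeSet → V := fun e ↦ (p e).2
  have hab : ∀ e, s(a e, b e) = e.1 := hp
  have hloop : ∀ e, a e ≠ b e := fun e ↦ SimpleGraph.Adj.ne (G := G) (by
    rw [← SimpleGraph.mem_edgeSet, hab]; exact e.2)
  have hncard : ∀ U : Finset V, #(edgeCut a b U) =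
      ({e ∈ G.edgeSet | ∃ v w : V, e = s(v, w) ∧ v ∈ U ∧ w ∉ U}).ncard := by
    intro U
    rw [← Set.ncard_coe_finset, ← Set.ncard_image_of_injective _ Subtype.val_injective]
    congr 1
    ext e
    simp only [Set.mem_image, mem_coe, mem_edgeCut, Set.mem_ofPred_eq]
    constructor
    · rintro ⟨e, he, rfl⟩
      refine ⟨e.2, ?_⟩
      by_cases h : a e ∈ U
      · exact ⟨a e, b e, (hab e).symm, h, by tauto⟩
      · exact ⟨b e, a e, (hab e).symm.trans Sym2.eq_swap, by tauto, h⟩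
    · rintro ⟨he, v, w, hvw, hv, hw⟩
      refine ⟨⟨e, he⟩, ?_, rfl⟩
      rcases Sym2.eq_iff.1 ((hab ⟨e, he⟩).trans hvw) with ⟨h1, h2⟩ | ⟨h1, h2⟩ <;>
        rw [h1, h2] <;> tauto
  have hdeg : ∀ v, #(edgeCut a b {v}) = 3 := by
    intro v
    rw [hncard, ← hreg v, ← Set.ncard_image_of_injective (f := fun w ↦ s(v, w)) (G.neighborSet v)
      (fun _ _ h ↦ Sym2.congr_right.1 h)]
    congr 1
    ext e
    simp only [Set.mem_ofPred_eq, mem_singleton, Set.mem_image, SimpleGraph.mem_neighborSet]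
    constructor
    · rintro ⟨he, u, w, rfl, rfl, -⟩
      exact ⟨w, he, rfl⟩
    · rintro ⟨w, h, rfl⟩
      exact ⟨h, v, w, rfl, rfl, h.ne'⟩
  obtain ⟨h, hV, hpow⟩ := two_pow_le_card_perfect_pow hloop hdeg
    (fun U h1 h2 ↦ (hcut U h1 (by omega)).trans_eq (hncard U).symm) hk
  refine (rpow_le_of_pow_le hk0 hV hpow).trans ?_
  exact_mod_cast card_perfectEdgeSets_le_ncard hab
end

section
/- Let γₙ be the standard Gaussian probability measure on ℝⁿ. For any ρ ≥ 0 and any vectors u₁, …, u_m ∈ ℝⁿ with ‖uᵢ‖ ≤ 1 for i = 1, …, m, the measure of the set {y ∈ ℝⁿ : |⟨uᵢ, y⟩| ≤ ρ for i = 1, …, m} is at least (1 − exp(−ρ²/2))^m. -/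
open MeasureTheory
open scoped RealInnerProductSpace

/-- The standard Gaussian probability measure on `ℝⁿ`, with density
`(2π)^{-n/2} e^{-‖x‖²/2}` with respect to Lebesgue measure. -/
noncomputable def stdGaussian (n : ℕ) : Measure (EuclideanSpace ℝ (Fin n)) :=
  volume.withDensity fun x =>
    ENNReal.ofReal ((2 * Real.pi) ^ (-(n : ℝ) / 2) * Real.exp (-‖x‖ ^ 2 / 2))

open Set
open scoped ENNReal NNReal

/-- An extended nonnegative function is log-concave if
`F x ^ a * F y ^ b ≤ F (a • x + b • y)` for all positive weights `a + b = 1`. -/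
def ENNLogConcave {V : Type*} [AddCommGroup V] [Module ℝ V] (F : V → ℝ≥0∞) : Prop :=
  ∀ ⦃x y : V⦄ ⦃a b : ℝ⦄, 0 < a → 0 < b → a + b = 1 → F x ^ a * F y ^ b ≤ F (a • x + b • y)

namespace ENNLogConcave

variable {V W : Type*} [AddCommGroup V] [Module ℝ V] [AddCommGroup W] [Module ℝ W]

theorem mul {F G : V → ℝ≥0∞} (hF : ENNLogConcave F) (hG : ENNLogConcave G) :
    ENNLogConcave fun x => F x * G x := by
  intro x y a b ha hb hab
  dsimp only
  rw [ENNReal.mul_rpow_of_nonneg _ _ ha.le, ENNReal.mul_rpow_of_nonneg _ _ hb.le,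
    mul_mul_mul_comm]
  exact mul_le_mul' (hF ha hb hab) (hG ha hb hab)

theorem const (c : ℝ≥0∞) : ENNLogConcave fun _ : V => c := by
  intro x y a b ha hb hab
  dsimp only
  rw [← ENNReal.rpow_add_of_nonneg _ _ ha.le hb.le, hab, ENNReal.rpow_one]

theorem comp_linearMap {F : W → ℝ≥0∞} (hF : ENNLogConcave F) (L : V →ₗ[ℝ] W) :
    ENNLogConcave fun x => F (L x) := by
  intro x y a b ha hb hab
  simpa only [map_add, map_smul] using hF (x := L x) (y := L y) ha hb hab

theorem indicator_one {K : Set V} (hK : Convex ℝ K) :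
    ENNLogConcave (K.indicator fun _ => (1 : ℝ≥0∞)) := by
  intro x y a b ha hb hab
  by_cases hx : x ∈ K
  · by_cases hy : y ∈ K
    · simp [hx, hy, hK hx hy ha.le hb.le hab]
    · simp [hy, hb]
  · simp [hx, ha]

theorem ordConnected_lt {f : ℝ → ℝ≥0∞} (hf : ENNLogConcave f) (t : ℝ≥0∞) :
    OrdConnected {x | t < f x} := by
  refine Convex.ordConnected (𝕜 := ℝ) (convex_iff_forall_pos.2 ?_)
  intro x hx y hy a b ha hb hab
  refine lt_of_lt_of_le (lt_min hx hy) (le_trans ?_ (hf ha hb hab))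
  calc min (f x) (f y) = min (f x) (f y) ^ a * min (f x) (f y) ^ b := by
        rw [← ENNReal.rpow_add_of_nonneg _ _ ha.le hb.le, hab, ENNReal.rpow_one]
    _ ≤ f x ^ a * f y ^ b := by gcongr <;> simp

end ENNLogConcave

theorem Set.OrdConnected.volume_eq_ediam {s : Set ℝ} (hs : s.OrdConnected) :
    volume s = Metric.ediam s := by
  refine le_antisymm (Real.volume_le_diam s) (Metric.ediam_le fun x hx y hy => ?_)
  calc edist x y = volume (uIcc x y) := by
        rw [Real.volume_interval, edist_comm, edist_dist, Real.dist_eq]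
    _ ≤ volume s := measure_mono (hs.uIcc_subset hx hy)

/-- The Brunn–Minkowski inequality for intervals of the line. -/
theorem Set.OrdConnected.brunn_minkowski {A B C : Set ℝ} (hA : A.OrdConnected)
    (hB : B.OrdConnected) (hC : C.OrdConnected) (hA' : A.Nonempty) (hB' : B.Nonempty)
    {a b : ℝ} (ha : 0 < a) (hb : 0 < b) (h : ∀ x ∈ A, ∀ y ∈ B, a * x + b * y ∈ C) :
    ENNReal.ofReal a * volume A + ENNReal.ofReal b * volume B ≤ volume C := by
  have key : ∀ s : Set ℝ, Metric.ediam s = ⨆ p : s × s, edist (p.1 : ℝ) p.2 := fun s => by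
    refine le_antisymm (Metric.ediam_le fun x hx y hy => ?_) (iSup_le fun p => ?_)
    · exact le_iSup (fun p : s × s => edist (p.1 : ℝ) p.2) (⟨x, hx⟩, ⟨y, hy⟩)
    · exact Metric.edist_le_ediam_of_mem p.1.2 p.2.2
  have ord : ∀ x ∈ A, ∀ x' ∈ A, ∀ y ∈ B, ∀ y' ∈ B, x ≤ x' → y ≤ y' →
      ENNReal.ofReal a * edist x x' + ENNReal.ofReal b * edist y y' ≤ volume C := by
    intro x hx x' hx' y hy y' hy' hxx hyy
    rw [hC.volume_eq_ediam]
    refine le_trans (le_of_eq ?_) (Metric.edist_le_ediam_of_mem (h x hx y hy) (h x' hx' y' hy'))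
    have h1 : 0 ≤ a * (x' - x) := mul_nonneg ha.le (sub_nonneg.2 hxx)
    have h2 : 0 ≤ b * (y' - y) := mul_nonneg hb.le (sub_nonneg.2 hyy)
    rw [edist_comm x, edist_comm y, edist_comm (a * x + b * y), edist_dist, edist_dist,
      edist_dist, Real.dist_eq, Real.dist_eq, Real.dist_eq, abs_of_nonneg (sub_nonneg.2 hxx),
      abs_of_nonneg (sub_nonneg.2 hyy), ← ENNReal.ofReal_mul ha.le, ← ENNReal.ofReal_mul hb.le,
      ← ENNReal.ofReal_add h1 h2, abs_of_nonneg (by linarith)]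
    congr 1
    ring
  have := hA'.to_subtype
  have := hB'.to_subtype
  rw [hA.volume_eq_ediam, hB.volume_eq_ediam, key A, key B, ENNReal.mul_iSup, ENNReal.mul_iSup]
  refine ENNReal.iSup_add_iSup_le ?_
  rintro ⟨⟨x, hx⟩, ⟨x', hx'⟩⟩ ⟨⟨y, hy⟩, ⟨y', hy'⟩⟩
  dsimp only
  rcases le_total x x' with hxx | hxx <;> rcases le_total y y' with hyy | hyy
  · exact ord x hx x' hx' y hy y' hy' hxx hyy
  · rw [edist_comm y]; exact ord x hx x' hx' y' hy' y hy hxx hyy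
  · rw [edist_comm x]; exact ord x' hx' x hx y hy y' hy' hxx hyy
  · rw [edist_comm x, edist_comm y]; exact ord x' hx' x hx y' hy' y hy hxx hyy

theorem lintegral_eq_lintegral_measure_ofReal_lt {α : Type*} [MeasurableSpace α] (μ : Measure α)
    {f : α → ℝ≥0∞} (hf : Measurable f) (hf' : ∀ x, f x ≠ ∞) :
    ∫⁻ x, f x ∂μ = ∫⁻ t in Ioi (0 : ℝ), μ {x | ENNReal.ofReal t < f x} := by
  have h := lintegral_eq_lintegral_meas_lt μ (f := fun x => (f x).toReal)
    (Filter.Eventually.of_forall fun x => ENNReal.toReal_nonneg) hf.ennreal_toReal.aemeasurable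
  simp only [ENNReal.ofReal_toReal (hf' _)] at h
  rw [h]
  refine setLIntegral_congr_fun measurableSet_Ioi fun t ht => ?_
  congr 1
  ext x
  simp only [mem_ofPred_eq]
  rw [ENNReal.ofReal_lt_iff_lt_toReal (le_of_lt ht) (hf' x)]

/-- The Prékopa–Leindler inequality, in arithmetic form, for log-concave functions on the line
with supremum one. -/
theorem ENNLogConcave.add_lintegral_le {f g h : ℝ → ℝ≥0∞} (hf : ENNLogConcave f)
    (hg : ENNLogConcave g) (hh : ENNLogConcave h) (mf : Measurable f) (mg : Measurable g)
    (mh : Measurable h) (sf : ⨆ x, f x = 1) (sg : ⨆ x, g x = 1) (fh : ∀ x, h x ≠ ∞)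
    {a b : ℝ} (ha : 0 < a) (hb : 0 < b) (hab : a + b = 1)
    (H : ∀ x y, f x ^ a * g y ^ b ≤ h (a * x + b * y)) :
    ENNReal.ofReal a * (∫⁻ x, f x) + ENNReal.ofReal b * (∫⁻ x, g x) ≤ ∫⁻ x, h x := by
  have f1 : ∀ x, f x ≤ 1 := fun x => sf ▸ le_iSup f x
  have g1 : ∀ x, g x ≤ 1 := fun x => sg ▸ le_iSup g x
  rw [lintegral_eq_lintegral_measure_ofReal_lt _ mf fun x => ((f1 x).trans_lt (by simp)).ne,
    lintegral_eq_lintegral_measure_ofReal_lt _ mg fun x => ((g1 x).trans_lt (by simp)).ne,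
    lintegral_eq_lintegral_measure_ofReal_lt _ mh fh]
  have anti : ∀ k : ℝ → ℝ≥0∞, Measurable fun t : ℝ => volume {x | ENNReal.ofReal t < k x} :=
    fun k => Antitone.measurable fun s t hst => measure_mono fun x hx =>
      lt_of_le_of_lt (ENNReal.ofReal_le_ofReal hst) hx
  rw [← lintegral_const_mul _ (anti f), ← lintegral_const_mul _ (anti g),
    ← lintegral_add_left ((anti f).const_mul _)]
  refine setLIntegral_mono (anti h) fun t ht => ?_
  by_cases ht1 : t < 1
  · have ht1' : ENNReal.ofReal t < 1 := by simpa using ht1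
    obtain ⟨x₀, hx₀⟩ := lt_iSup_iff.1 (sf.symm ▸ ht1')
    obtain ⟨y₀, hy₀⟩ := lt_iSup_iff.1 (sg.symm ▸ ht1')
    refine Set.OrdConnected.brunn_minkowski (hf.ordConnected_lt _) (hg.ordConnected_lt _)
      (hh.ordConnected_lt _) ⟨x₀, hx₀⟩ ⟨y₀, hy₀⟩ ha hb ?_
    intro x hx y hy
    refine lt_of_lt_of_le ?_ (H x y)
    refine lt_of_lt_of_le (lt_min hx hy) ?_
    calc min (f x) (g y) = min (f x) (g y) ^ a * min (f x) (g y) ^ b := by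
          rw [← ENNReal.rpow_add_of_nonneg _ _ ha.le hb.le, hab, ENNReal.rpow_one]
      _ ≤ f x ^ a * g y ^ b := by gcongr <;> simp
  · have ht1' : 1 ≤ ENNReal.ofReal t := by simpa using ht1
    have e1 : {x | ENNReal.ofReal t < f x} = ∅ :=
      eq_empty_of_forall_notMem fun x hx => (hx.trans_le (f1 x)).not_ge ht1'
    have e2 : {x | ENNReal.ofReal t < g x} = ∅ :=
      eq_empty_of_forall_notMem fun x hx => (hx.trans_le (g1 x)).not_ge ht1'
    simp [e1, e2]

theorem ENNReal.rpow_mul_rpow_le_add (p q : ℝ≥0∞) {a b : ℝ} (ha : 0 < a) (hb : 0 < b)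
    (hab : a + b = 1) :
    p ^ a * q ^ b ≤ ENNReal.ofReal a * p + ENNReal.ofReal b * q := by
  rcases eq_or_ne p ∞ with rfl | hp
  · simp [ENNReal.mul_top, ha]
  rcases eq_or_ne q ∞ with rfl | hq
  · simp [ENNReal.mul_top, hb]
  lift p to ℝ≥0 using hp
  lift q to ℝ≥0 using hq
  have := NNReal.geom_mean_le_arith_mean2_weighted a.toNNReal b.toNNReal p q
    (by rw [← Real.toNNReal_add ha.le hb.le, hab, Real.toNNReal_one])
  rw [Real.coe_toNNReal _ ha.le, Real.coe_toNNReal _ hb.le] at this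
  rw [← ENNReal.coe_rpow_of_nonneg _ ha.le, ← ENNReal.coe_rpow_of_nonneg _ hb.le]
  unfold ENNReal.ofReal
  exact_mod_cast this

/-- The Prékopa–Leindler inequality for bounded log-concave functions on the line. -/
theorem ENNLogConcave.prekopa_leindler {f g h : ℝ → ℝ≥0∞} (hf : ENNLogConcave f)
    (hg : ENNLogConcave g) (hh : ENNLogConcave h) (mf : Measurable f) (mg : Measurable g)
    (mh : Measurable h) (f1 : ∀ x, f x ≤ 1) (g1 : ∀ x, g x ≤ 1) (h1 : ∀ x, h x ≤ 1)
    {a b : ℝ} (ha : 0 < a) (hb : 0 < b) (hab : a + b = 1)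
    (H : ∀ x y, f x ^ a * g y ^ b ≤ h (a * x + b * y)) :
    (∫⁻ x, f x) ^ a * (∫⁻ x, g x) ^ b ≤ ∫⁻ x, h x := by
  set M := ⨆ x, f x with hM
  set N := ⨆ x, g x with hN
  have Mt : M ≠ ∞ := ((iSup_le f1).trans_lt (by simp)).ne
  have Nt : N ≠ ∞ := ((iSup_le g1).trans_lt (by simp)).ne
  rcases eq_or_ne M 0 with M0 | M0
  · have : ∀ x, f x = 0 := fun x => le_antisymm (M0 ▸ le_iSup f x) zero_le
    simp [this, ha]
  rcases eq_or_ne N 0 with N0 | N0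
  · have : ∀ x, g x = 0 := fun x => le_antisymm (N0 ▸ le_iSup g x) zero_le
    simp [this, hb]
  set P := M ^ a * N ^ b with hP
  have P0 : P ≠ 0 := mul_ne_zero (by simp [ENNReal.rpow_eq_zero_iff, M0, Mt])
    (by simp [ENNReal.rpow_eq_zero_iff, N0, Nt])
  have Pt : P ≠ ∞ := ENNReal.mul_ne_top (ENNReal.rpow_ne_top_of_nonneg ha.le Mt)
    (ENNReal.rpow_ne_top_of_nonneg hb.le Nt)
  have key := ENNLogConcave.add_lintegral_le (f := fun x => M⁻¹ * f x) (g := fun x => N⁻¹ * g x)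
    (h := fun x => P⁻¹ * h x) ((ENNLogConcave.const _).mul hf) ((ENNLogConcave.const _).mul hg)
    ((ENNLogConcave.const _).mul hh) (mf.const_mul _) (mg.const_mul _) (mh.const_mul _)
    (by rw [← ENNReal.mul_iSup, ← hM, ENNReal.inv_mul_cancel M0 Mt])
    (by rw [← ENNReal.mul_iSup, ← hN, ENNReal.inv_mul_cancel N0 Nt])
    (fun x => ENNReal.mul_ne_top (ENNReal.inv_ne_top.2 P0) ((h1 x).trans_lt (by simp)).ne)
    ha hb hab (fun x y => by
      have e : P⁻¹ = M⁻¹ ^ a * N⁻¹ ^ b := by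
        rw [hP, ENNReal.mul_inv (Or.inr (ENNReal.rpow_ne_top_of_nonneg hb.le Nt))
          (Or.inl (ENNReal.rpow_ne_top_of_nonneg ha.le Mt)), ENNReal.inv_rpow, ENNReal.inv_rpow]
      rw [ENNReal.mul_rpow_of_nonneg _ _ ha.le, ENNReal.mul_rpow_of_nonneg _ _ hb.le,
        mul_mul_mul_comm, e]
      exact mul_le_mul' le_rfl (H x y))
  have key2 := (ENNReal.rpow_mul_rpow_le_add _ _ ha hb hab).trans key
  rw [lintegral_const_mul _ mf, lintegral_const_mul _ mg, lintegral_const_mul _ mh,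
    ENNReal.mul_rpow_of_nonneg _ _ ha.le, ENNReal.mul_rpow_of_nonneg _ _ hb.le,
    mul_mul_mul_comm, ENNReal.inv_rpow, ENNReal.inv_rpow,
    ← ENNReal.mul_inv (Or.inr (ENNReal.rpow_ne_top_of_nonneg hb.le Nt))
          (Or.inl (ENNReal.rpow_ne_top_of_nonneg ha.le Mt)), ← hP] at key2
  exact (ENNReal.mul_le_mul_iff_right (ENNReal.inv_ne_zero.2 Pt) (ENNReal.inv_ne_top.2 P0)).1 key2

open ProbabilityTheory (gaussianReal gaussianPDF gaussianPDFReal)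

theorem ennLogConcave_gaussianPDF : ENNLogConcave (gaussianPDF 0 1) := by
  have e : gaussianPDF 0 1 = fun x => ENNReal.ofReal (√(2 * Real.pi))⁻¹ *
      ENNReal.ofReal (Real.exp (-x ^ 2 / 2)) := by
    ext x
    rw [gaussianPDF, gaussianPDFReal, ← ENNReal.ofReal_mul (by positivity)]
    simp
  rw [e]
  refine (ENNLogConcave.const _).mul ?_
  intro x y a b ha hb hab
  dsimp only
  rw [ENNReal.ofReal_rpow_of_pos (Real.exp_pos _), ENNReal.ofReal_rpow_of_pos (Real.exp_pos _),
    ← ENNReal.ofReal_mul (by positivity), ← Real.exp_mul, ← Real.exp_mul, ← Real.exp_add]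
  refine ENNReal.ofReal_le_ofReal (Real.exp_le_exp.2 ?_)
  obtain rfl : b = 1 - a := by linarith
  simp only [smul_eq_mul]
  nlinarith [mul_nonneg (mul_pos ha hb).le (sq_nonneg (x - y))]

theorem gaussianPDF_zero_one_le_one (x : ℝ) : gaussianPDF 0 1 x ≤ 1 := by
  rw [gaussianPDF, gaussianPDFReal, ENNReal.ofReal_le_one]
  refine mul_le_one₀ (inv_le_one_of_one_le₀ (Real.one_le_sqrt.2 ?_)) (Real.exp_pos _).le
    (Real.exp_le_one_iff.2 ?_)
  · have := Real.pi_gt_three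
    simp only [NNReal.coe_one, mul_one]
    linarith
  · have := sq_nonneg (x - 0)
    simp only [NNReal.coe_one, mul_one]
    linarith

theorem lintegral_gaussianReal {f : ℝ → ℝ≥0∞} (hf : Measurable f) :
    ∫⁻ x, f x ∂(gaussianReal 0 1) = ∫⁻ x, gaussianPDF 0 1 x * f x := by
  rw [ProbabilityTheory.gaussianReal_of_var_ne_zero 0 one_ne_zero,
    lintegral_withDensity_eq_lintegral_mul _ (ProbabilityTheory.measurable_gaussianPDF 0 1) hf]
  rfl

/-- Gaussian marginals of log-concave functions are log-concave. -/
theorem ENNLogConcave.lintegral_gaussianReal {V : Type*} [AddCommGroup V] [Module ℝ V]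
    {F : V × ℝ → ℝ≥0∞} (hF : ENNLogConcave F) (mF : ∀ x, Measurable fun s => F (x, s))
    (F1 : ∀ p, F p ≤ 1) : ENNLogConcave fun x => ∫⁻ s, F (x, s) ∂(gaussianReal 0 1) := by
  have slice : ∀ x, ENNLogConcave fun s => F (x, s) := fun x s t a b ha hb hab => by
    have := hF (x := (x, s)) (y := (x, t)) ha hb hab
    simpa only [Prod.smul_mk, Prod.mk_add_mk, ← add_smul, hab, one_smul] using this
  have mP := ProbabilityTheory.measurable_gaussianPDF 0 1
  have bd : ∀ x s, gaussianPDF 0 1 s * F (x, s) ≤ 1 := fun x s =>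
    mul_le_one' (gaussianPDF_zero_one_le_one s) (F1 _)
  intro x y a b ha hb hab
  simp only [_root_.lintegral_gaussianReal (mF _)]
  refine ENNLogConcave.prekopa_leindler (ennLogConcave_gaussianPDF.mul (slice x))
    (ennLogConcave_gaussianPDF.mul (slice y)) (ennLogConcave_gaussianPDF.mul (slice _))
    (mP.mul (mF x)) (mP.mul (mF y)) (mP.mul (mF _)) (bd x) (bd y) (bd _) ha hb hab ?_
  intro s t
  rw [ENNReal.mul_rpow_of_nonneg _ _ ha.le, ENNReal.mul_rpow_of_nonneg _ _ hb.le,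
    mul_mul_mul_comm]
  exact mul_le_mul' (ennLogConcave_gaussianPDF ha hb hab) (hF (x := (x, s)) (y := (y, t)) ha hb hab)

/-- The product of `k` standard Gaussian measures on the line. -/
noncomputable def piGaussian (k : ℕ) : Measure (Fin k → ℝ) :=
  Measure.pi fun _ => gaussianReal 0 1

instance (k : ℕ) : IsProbabilityMeasure (piGaussian k) := by
  unfold piGaussian; infer_instance

theorem measurable_finCons (k : ℕ) :
    Measurable fun p : ℝ × (Fin k → ℝ) => (Fin.cons p.1 p.2 : Fin (k + 1) → ℝ) := by
  refine measurable_pi_lambda _ fun i => ?_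
  refine Fin.cases ?_ (fun j => ?_) i
  · simpa using measurable_fst
  · simpa [Function.comp_def] using (measurable_pi_apply j).comp measurable_snd

theorem lintegral_pi_fin_succ {k : ℕ} {μ : Fin (k + 1) → Measure ℝ} [∀ i, SigmaFinite (μ i)]
    {f : (Fin (k + 1) → ℝ) → ℝ≥0∞} (hf : Measurable f) :
    ∫⁻ x, f x ∂(Measure.pi μ) =
      ∫⁻ s, ∫⁻ z, f (Fin.cons s z) ∂(Measure.pi fun j => μ j.succ) ∂(μ 0) := by
  have h := (measurePreserving_piFinSuccAbove μ 0).symm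
  rw [← h.lintegral_comp hf, lintegral_prod (fun p => f ((MeasurableEquiv.piFinSuccAbove (fun _ => ℝ) 0).symm p))
      (hf.comp h.measurable).aemeasurable]
  simp only [MeasurableEquiv.piFinSuccAbove_symm_apply, Fin.succAbove_zero]
  refine lintegral_congr fun s => lintegral_congr fun z => congrArg f ?_
  exact Fin.insertNth_zero (α := fun _ => ℝ) s z

theorem ENNLogConcave.lintegral_piGaussian (k : ℕ) :
    ∀ {V : Type} [AddCommGroup V] [Module ℝ V] [MeasurableSpace V]
    {F : V × (Fin k → ℝ) → ℝ≥0∞}, ENNLogConcave F → Measurable F → (∀ p, F p ≤ 1) →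
    ENNLogConcave fun x => ∫⁻ z, F (x, z) ∂(piGaussian k) := by
  induction k with
  | zero =>
    intro V _ _ _ F hF mF F1
    have : ∀ x, ∫⁻ z, F (x, z) ∂(piGaussian 0) = F (x, 0) := fun x => by
      rw [lintegral_unique]
      rw [measure_univ, mul_one]
      exact congrArg (fun z => F (x, z)) (Subsingleton.elim _ _)
    simp only [this]
    exact hF.comp_linearMap (LinearMap.inl ℝ V (Fin 0 → ℝ))
  | succ k ih =>
    intro V _ _ _ F hF mF F1
    let L : (V × ℝ) × (Fin k → ℝ) →ₗ[ℝ] V × (Fin (k + 1) → ℝ) :=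
      { toFun := fun p => (p.1.1, Fin.cons p.1.2 p.2)
        map_add' := fun p q => by
          refine Prod.ext rfl (funext fun i => ?_)
          refine Fin.cases ?_ (fun j => ?_) i <;> simp
        map_smul' := fun c p => by
          refine Prod.ext rfl (funext fun i => ?_)
          refine Fin.cases ?_ (fun j => ?_) i <;> simp }
    have mL : Measurable L := (measurable_fst.comp measurable_fst).prodMk
      ((measurable_finCons k).comp
        ((measurable_snd.comp measurable_fst).prodMk measurable_snd))
    have hG := ih (hF.comp_linearMap L) (mF.comp mL) (fun p => F1 _)
    have mG : Measurable fun p : V × ℝ => ∫⁻ z, F (L (p, z)) ∂(piGaussian k) :=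
      (mF.comp mL).lintegral_prod_right'
    have := hG.lintegral_gaussianReal (fun x => mG.comp measurable_prodMk_left) (fun p => by
      calc ∫⁻ z, F (L (p, z)) ∂(piGaussian k) ≤ ∫⁻ _, 1 ∂(piGaussian k) :=
            lintegral_mono fun z => F1 _
        _ = 1 := by simp)
    convert this using 2 with x
    exact lintegral_pi_fin_succ (mF.comp measurable_prodMk_left)

theorem measurePreserving_neg_piGaussian (k : ℕ) :
    MeasurePreserving (fun z : Fin k → ℝ => -z) (piGaussian k) (piGaussian k) :=
  measurePreserving_pi (fun _ => gaussianReal 0 1) (fun _ => gaussianReal 0 1)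
    (f := fun _ x => -x)
    fun _ => ⟨measurable_neg, by rw [ProbabilityTheory.gaussianReal_map_neg, neg_zero]⟩

/-- Chebyshev's association inequality for a function decreasing in `|t|` and a centred interval. -/
theorem lintegral_mul_measure_Icc_le {μ : Measure ℝ} [IsProbabilityMeasure μ] {g : ℝ → ℝ≥0∞}
    (hg : ∀ s t, |s| ≤ |t| → g t ≤ g s) {r : ℝ} (hr : 0 ≤ r) :
    (∫⁻ t, g t ∂μ) * μ (Icc (-r) r) ≤ ∫⁻ t in Icc (-r) r, g t ∂μ := by
  set S := Icc (-r) r with hS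
  have mS : MeasurableSet S := measurableSet_Icc
  have hA : g r * μ S ≤ ∫⁻ t in S, g t ∂μ := by
    rw [← setLIntegral_const]
    refine setLIntegral_mono' mS fun t ht => hg _ _ ?_
    rw [abs_of_nonneg hr]
    exact abs_le.2 ht
  have hB : ∫⁻ t in Sᶜ, g t ∂μ ≤ g r * μ Sᶜ := by
    rw [← setLIntegral_const]
    refine setLIntegral_mono' mS.compl fun t ht => hg _ _ ?_
    rw [abs_of_nonneg hr]
    by_contra h
    exact ht (abs_le.1 (not_le.1 h).le)
  calc (∫⁻ t, g t ∂μ) * μ S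
      = (∫⁻ t in S, g t ∂μ) * μ S + (∫⁻ t in Sᶜ, g t ∂μ) * μ S := by
        rw [← lintegral_add_compl g mS, add_mul]
    _ ≤ (∫⁻ t in S, g t ∂μ) * μ S + g r * μ Sᶜ * μ S := by gcongr
    _ = (∫⁻ t in S, g t ∂μ) * μ S + g r * μ S * μ Sᶜ := by rw [mul_right_comm]
    _ ≤ (∫⁻ t in S, g t ∂μ) * μ S + (∫⁻ t in S, g t ∂μ) * μ Sᶜ := by gcongr
    _ = ∫⁻ t in S, g t ∂μ := by rw [← mul_add, measure_add_measure_compl mS, measure_univ, mul_one]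

/-- A symmetric convex set and a symmetric coordinate slab are positively correlated under the
standard Gaussian measure. -/
theorem piGaussian_mul_le_inter_slab {k : ℕ} {K : Set (Fin (k + 1) → ℝ)} (mK : MeasurableSet K)
    (cK : Convex ℝ K) (sK : ∀ x ∈ K, -x ∈ K) {r : ℝ} (hr : 0 ≤ r) :
    piGaussian (k + 1) K * gaussianReal 0 1 (Icc (-r) r) ≤
      piGaussian (k + 1) (K ∩ {x | |x 0| ≤ r}) := by
  let L : ℝ × (Fin k → ℝ) →ₗ[ℝ] Fin (k + 1) → ℝ :=
    { toFun := fun p => Fin.cons p.1 p.2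
      map_add' := fun p q => by
        refine funext fun i => ?_
        refine Fin.cases ?_ (fun j => ?_) i <;> simp
      map_smul' := fun c p => by
        refine funext fun i => ?_
        refine Fin.cases ?_ (fun j => ?_) i <;> simp }
  have mL : Measurable L := measurable_finCons k
  set F : (Fin (k + 1) → ℝ) → ℝ≥0∞ := K.indicator fun _ => 1 with hF
  have mF : Measurable F := measurable_const.indicator mK
  have F1 : ∀ x, F x ≤ 1 := fun x => indicator_le_self' (fun _ _ => zero_le) x
  have Fneg : ∀ x, F (-x) = F x := fun x => by
    have : -x ∈ K ↔ x ∈ K := ⟨fun h => by simpa using sK _ h, sK x⟩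
    by_cases h : x ∈ K <;> simp [hF, this, h]
  set g : ℝ → ℝ≥0∞ := fun t => ∫⁻ z, F (L (t, z)) ∂(piGaussian k) with hg
  have cg : ENNLogConcave g := ENNLogConcave.lintegral_piGaussian k
    ((ENNLogConcave.indicator_one cK).comp_linearMap L) (mF.comp mL) fun p => F1 _
  have neg_g : ∀ t, g (-t) = g t := fun t => by
    have mt : Measurable fun z => F (L (-t, z)) := (mF.comp mL).comp measurable_prodMk_left
    simp only [hg]
    rw [← (measurePreserving_neg_piGaussian k).lintegral_comp mt]
    refine lintegral_congr fun z => ?_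
    rw [← Prod.neg_mk, map_neg, Fneg]
  have mono_g : ∀ s t, |s| ≤ |t| → g t ≤ g s := by
    have abs_g : ∀ t, g |t| = g t := fun t => by
      rcases abs_choice t with h | h <;> rw [h]
      exact neg_g t
    intro s t hst
    rw [← abs_g t]
    rcases hst.eq_or_lt with h | h
    · rw [← h, abs_g]
    · have ht : 0 < |t| := (abs_nonneg s).trans_lt h
      have h1 := abs_lt.1 h
      have key := cg (x := |t|) (y := -|t|) (a := (|t| + s) / (2 * |t|))
        (b := (|t| - s) / (2 * |t|)) (div_pos (by linarith) (by linarith))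
        (div_pos (by linarith) (by linarith)) (by field_simp; ring)
      rw [neg_g, ← ENNReal.rpow_add_of_nonneg _ _ (div_pos (by linarith) (by linarith)).le
        (div_pos (by linarith) (by linarith)).le] at key
      have e1 : (|t| + s) / (2 * |t|) + (|t| - s) / (2 * |t|) = 1 := by field_simp; ring
      have e2 : ((|t| + s) / (2 * |t|)) • |t| + ((|t| - s) / (2 * |t|)) • -|t| = s := by
        simp only [smul_eq_mul]; field_simp; ring
      rwa [e1, e2, ENNReal.rpow_one] at key
  have hS : MeasurableSet {x : Fin (k + 1) → ℝ | |x 0| ≤ r} :=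
    measurableSet_le (by fun_prop) measurable_const
  have eK : piGaussian (k + 1) K = ∫⁻ t, g t ∂(gaussianReal 0 1) := by
    rw [← lintegral_indicator_one mK]
    exact lintegral_pi_fin_succ mF
  have eKS : piGaussian (k + 1) (K ∩ {x | |x 0| ≤ r}) =
      ∫⁻ t in Icc (-r) r, g t ∂(gaussianReal 0 1) := by
    rw [← lintegral_indicator_one (mK.inter hS), ← lintegral_indicator measurableSet_Icc]
    refine (lintegral_pi_fin_succ (measurable_one.indicator (mK.inter hS))).trans ?_
    refine lintegral_congr fun t => ?_
    by_cases ht : t ∈ Icc (-r) r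
    · rw [indicator_of_mem ht]
      refine lintegral_congr fun z => ?_
      have ht' : |t| ≤ r := abs_le.2 ht
      have : (Fin.cons t z : Fin (k + 1) → ℝ) ∈ K ∩ {x | |x 0| ≤ r} ↔ Fin.cons t z ∈ K :=
        and_iff_left ht'
      change indicator _ _ _ = K.indicator _ (Fin.cons t z)
      by_cases hz : (Fin.cons t z : Fin (k + 1) → ℝ) ∈ K
      · rw [indicator_of_mem (this.2 hz), indicator_of_mem hz, Pi.one_apply]
      · rw [indicator_of_notMem (fun h => hz (this.1 h)), indicator_of_notMem hz]
    · rw [indicator_of_notMem ht]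
      have ht' : ¬ |t| ≤ r := fun h => ht (abs_le.1 h)
      simp [indicator, ht']
  rw [eK, eKS]
  exact lintegral_mul_measure_Icc_le mono_g hr

theorem lintegral_pi_prod_eq_prod (n : ℕ) (μ : Fin n → Measure ℝ) [∀ i, SigmaFinite (μ i)]
    (f : Fin n → ℝ → ℝ≥0∞) (hf : ∀ i, Measurable (f i)) :
    ∫⁻ x, ∏ i, f i (x i) ∂(Measure.pi μ) = ∏ i, ∫⁻ t, f i t ∂(μ i) := by
  induction n with
  | zero => simp
  | succ n ih =>
    have m : Measurable fun x : Fin (n + 1) → ℝ => ∏ i, f i (x i) :=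
      Finset.measurable_prod _ fun i _ => (hf i).comp (measurable_pi_apply i)
    rw [lintegral_pi_fin_succ m, Fin.prod_univ_succ]
    simp only [Fin.prod_univ_succ, Fin.cons_zero, Fin.cons_succ]
    have : ∀ s : ℝ, ∫⁻ z : Fin n → ℝ, f 0 s * ∏ i : Fin n, f i.succ (z i)
        ∂(Measure.pi fun j => μ j.succ) = f 0 s * ∏ i : Fin n, ∫⁻ t, f i.succ t ∂(μ i.succ) :=
      fun s => by
        rw [lintegral_const_mul _ (Finset.measurable_prod _ fun i _ =>
          (hf i.succ).comp (measurable_pi_apply i)),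
          ih (fun j => μ j.succ) (fun j => f j.succ) fun j => hf j.succ]
    simp only [this]
    rw [lintegral_mul_const _ (hf 0)]

theorem piGaussian_eq_withDensity (n : ℕ) :
    piGaussian n = volume.withDensity fun x => ∏ i, gaussianPDF 0 1 (x i) := by
  refine Measure.pi_eq fun s hs => ?_
  have mP := ProbabilityTheory.measurable_gaussianPDF 0 1
  rw [withDensity_apply _ (MeasurableSet.univ_pi hs), volume_pi, Measure.restrict_pi_pi,
    lintegral_pi_prod_eq_prod n _ _ fun _ => mP]
  exact Finset.prod_congr rfl fun i _ =>
    (ProbabilityTheory.gaussianReal_apply 0 one_ne_zero (s i)).symm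

theorem stdGaussian_eq (n : ℕ) :
    stdGaussian n = ProbabilityTheory.stdGaussian (EuclideanSpace ℝ (Fin n)) := by
  rw [← ProbabilityTheory.map_pi_eq_stdGaussian]
  have hT := PiLp.volume_preserving_toLp (Fin n)
  ext s hs
  rw [Measure.map_apply hT.measurable hs]
  change _ = piGaussian n _
  have m1 : Measurable fun x : EuclideanSpace ℝ (Fin n) =>
    ENNReal.ofReal ((2 * Real.pi) ^ (-(n : ℝ) / 2) * Real.exp (-‖x‖ ^ 2 / 2)) := by fun_prop
  rw [piGaussian_eq_withDensity, stdGaussian, withDensity_apply _ hs,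
    withDensity_apply _ (hT.measurable hs), ← hT.setLIntegral_comp_preimage hs m1]
  refine lintegral_congr fun x => ?_
  simp only [gaussianPDF, gaussianPDFReal]
  rw [← ENNReal.ofReal_prod_of_nonneg fun i _ => by positivity, Finset.prod_mul_distrib,
    ← Real.exp_sum, EuclideanSpace.real_norm_sq_eq]
  congr 2
  · simp only [NNReal.coe_one, mul_one, Finset.prod_const, Finset.card_univ, Fintype.card_fin]
    rw [Real.sqrt_eq_rpow, ← Real.rpow_neg (by positivity), ← Real.rpow_natCast,
      ← Real.rpow_mul (by positivity)]
    congr 1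
    ring
  · simp [← Finset.sum_div]

theorem gaussianReal_Ioi_le {r : ℝ} (hr : 0 ≤ r) :
    gaussianReal 0 1 (Ioi r) ≤
      ENNReal.ofReal (Real.exp (-(r ^ 2) / 2)) * gaussianReal 0 1 (Ioi 0) := by
  have mP := ProbabilityTheory.measurable_gaussianPDF 0 1
  have hpre : (fun x => x + r) ⁻¹' Ioi r = Ioi 0 := by
    ext x
    simp
  rw [ProbabilityTheory.gaussianReal_apply 0 one_ne_zero,
    ProbabilityTheory.gaussianReal_apply 0 one_ne_zero,
    ← (measurePreserving_add_right volume r).setLIntegral_comp_preimage measurableSet_Ioi mP,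
    hpre, ← lintegral_const_mul _ mP]
  refine setLIntegral_mono (mP.const_mul _) fun x hx => ?_
  rw [gaussianPDF, gaussianPDF, gaussianPDFReal, gaussianPDFReal,
    ← ENNReal.ofReal_mul (Real.exp_pos _).le, mul_left_comm, ← Real.exp_add]
  refine ENNReal.ofReal_le_ofReal (mul_le_mul_of_nonneg_left (Real.exp_le_exp.2 ?_) (by positivity))
  have := mul_nonneg (le_of_lt hx) hr
  simp only [NNReal.coe_one, mul_one]
  nlinarith

theorem one_sub_exp_le_gaussianReal_Icc {r : ℝ} (hr : 0 ≤ r) :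
    ENNReal.ofReal (1 - Real.exp (-(r ^ 2) / 2)) ≤ gaussianReal 0 1 (Icc (-r) r) := by
  set γ := gaussianReal 0 1 with hγ
  have neg_γ : ∀ s : ℝ, γ (Iio (-s)) = γ (Ioi s) := fun s => by
    have h : γ.map (fun x => -x) = γ := by rw [hγ, ProbabilityTheory.gaussianReal_map_neg, neg_zero]
    rw [← h, Measure.map_apply measurable_neg measurableSet_Iio,
      Measure.map_apply measurable_neg measurableSet_Ioi]
    nth_rewrite 2 [← h]
    rw [Measure.map_apply measurable_neg (measurable_neg measurableSet_Ioi)]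
    congr 1
    ext x
    simp
  have hc : γ (Icc (-r) r)ᶜ ≤ ENNReal.ofReal (Real.exp (-(r ^ 2) / 2)) := by
    have hsub : (Icc (-r) r)ᶜ ⊆ Iio (-r) ∪ Ioi r := fun x hx => by
      by_contra h
      simp only [mem_union, mem_Iio, mem_Ioi, not_or, not_lt] at h
      exact hx h
    have hd : Disjoint (Iio (0 : ℝ)) (Ioi 0) :=
      Set.disjoint_left.2 fun x h1 h2 => lt_asymm (mem_Iio.1 h1) (mem_Ioi.1 h2)
    calc γ (Icc (-r) r)ᶜ ≤ γ (Iio (-r)) + γ (Ioi r) :=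
          (measure_mono hsub).trans (measure_union_le _ _)
      _ = γ (Ioi r) + γ (Ioi r) := by rw [neg_γ]
      _ ≤ ENNReal.ofReal (Real.exp (-(r ^ 2) / 2)) * γ (Ioi 0) +
          ENNReal.ofReal (Real.exp (-(r ^ 2) / 2)) * γ (Ioi 0) :=
          add_le_add (gaussianReal_Ioi_le hr) (gaussianReal_Ioi_le hr)
      _ = ENNReal.ofReal (Real.exp (-(r ^ 2) / 2)) * γ (Iio 0 ∪ Ioi 0) := by
          rw [measure_union hd measurableSet_Ioi, ← neg_γ 0, neg_zero, mul_add]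
      _ ≤ ENNReal.ofReal (Real.exp (-(r ^ 2) / 2)) := mul_le_of_le_one_right' prob_le_one
  rw [ENNReal.ofReal_sub _ (Real.exp_pos _).le, ENNReal.ofReal_one, tsub_le_iff_right]
  calc (1 : ℝ≥0∞) = γ (Icc (-r) r) + γ (Icc (-r) r)ᶜ := by
        rw [measure_add_measure_compl measurableSet_Icc, measure_univ]
    _ ≤ _ := by gcongr

/-- Šidák's lemma, with the slab measure replaced by its elementary lower bound. -/
theorem stdGaussian_mul_le_inter_slab {n : ℕ} {K : Set (EuclideanSpace ℝ (Fin n))}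
    (mK : MeasurableSet K) (cK : Convex ℝ K) (sK : ∀ x ∈ K, -x ∈ K)
    {u : EuclideanSpace ℝ (Fin n)} (hu : ‖u‖ ≤ 1) {ρ : ℝ} (hρ : 0 ≤ ρ) :
    stdGaussian n K * ENNReal.ofReal (1 - Real.exp (-(ρ ^ 2) / 2)) ≤
      stdGaussian n (K ∩ {y | |⟪u, y⟫| ≤ ρ}) := by
  rcases eq_or_ne u 0 with rfl | hu0
  · have : {y : EuclideanSpace ℝ (Fin n) | |⟪(0 : EuclideanSpace ℝ (Fin n)), y⟫| ≤ ρ} = univ :=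
      eq_univ_of_forall fun y => by simpa using hρ
    rw [this, inter_univ]
    refine mul_le_of_le_one_right' ?_
    rw [ENNReal.ofReal_le_one]
    linarith [Real.exp_pos (-(ρ ^ 2) / 2)]
  obtain _ | k := n
  · exact absurd (Subsingleton.elim u 0) hu0
  have hpos : 0 < ‖u‖ := norm_pos_iff.2 hu0
  obtain ⟨b, hb⟩ := Orthonormal.exists_orthonormalBasis_extension_of_card_eq (𝕜 := ℝ)
    (E := EuclideanSpace ℝ (Fin (k + 1))) (ι := Fin (k + 1)) (by simp)
    (v := fun _ => ‖u‖⁻¹ • u) (s := {0}) (by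
      refine ⟨fun i => ?_, fun i j hij => absurd (Subsingleton.elim i j) hij⟩
      simp [norm_smul, hpos.ne'])
  have hb0 : u = ‖u‖ • b 0 := by
    rw [hb 0 rfl, smul_smul, mul_inv_cancel₀ hpos.ne', one_smul]
  let T : (Fin (k + 1) → ℝ) →ₗ[ℝ] EuclideanSpace ℝ (Fin (k + 1)) :=
    { toFun := fun x => ∑ i, x i • b i
      map_add' := fun x y => by simp [add_smul, Finset.sum_add_distrib]
      map_smul' := fun c x => by simp [mul_smul, Finset.smul_sum] }
  have mT : Measurable T := by
    change Measurable fun x : Fin (k + 1) → ℝ => ∑ i, x i • b i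
    fun_prop
  have hT : ∀ x, ⟪u, T x⟫ = ‖u‖ * x 0 := fun x => by
    have : ⟪b 0, T x⟫ = x 0 := by
      change ⟪b 0, ∑ i, x i • b i⟫ = x 0
      exact b.orthonormal.inner_right_fintype x 0
    conv_lhs => rw [hb0]
    rw [real_inner_smul_left, this]
  have hmap : stdGaussian (k + 1) = (piGaussian (k + 1)).map T := by
    rw [stdGaussian_eq, ProbabilityTheory.stdGaussian_eq_map_pi_orthonormalBasis b]
    rfl
  have mS : MeasurableSet {y : EuclideanSpace ℝ (Fin (k + 1)) | |⟪u, y⟫| ≤ ρ} :=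
    measurableSet_le (by fun_prop) measurable_const
  rw [hmap, Measure.map_apply mT mK, Measure.map_apply mT (mK.inter mS)]
  calc piGaussian (k + 1) (T ⁻¹' K) * ENNReal.ofReal (1 - Real.exp (-(ρ ^ 2) / 2))
      ≤ piGaussian (k + 1) (T ⁻¹' K) * gaussianReal 0 1 (Icc (-ρ) ρ) := by
        gcongr
        exact one_sub_exp_le_gaussianReal_Icc hρ
    _ ≤ piGaussian (k + 1) (T ⁻¹' K ∩ {x | |x 0| ≤ ρ}) :=
        piGaussian_mul_le_inter_slab (mT mK) (cK.linear_preimage T)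
          (fun x hx => by
            have := sK _ hx
            rwa [← map_neg] at this) hρ
    _ ≤ piGaussian (k + 1) (T ⁻¹' (K ∩ {y | |⟪u, y⟫| ≤ ρ})) := by
        refine measure_mono fun x hx => ⟨hx.1, ?_⟩
        have h2 : |x 0| ≤ ρ := hx.2
        change |⟪u, T x⟫| ≤ ρ
        rw [hT, abs_mul, abs_of_pos hpos]
        exact (mul_le_of_le_one_left (abs_nonneg _) hu).trans h2

/-- Lemma 2.1(3) (via the Šidák lemma): for `ρ ≥ 0` and vectors `u₁, …, u_m ∈ ℝⁿ` with
`‖uᵢ‖ ≤ 1`, the standard Gaussian measure of `{y : |⟨uᵢ, y⟩| ≤ ρ, i = 1,…,m}` is at least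
`(1 - e^{-ρ²/2})^m`. -/
theorem stmt_8 (n m : ℕ) (ρ : ℝ) (hρ : 0 ≤ ρ) (u : Fin m → EuclideanSpace ℝ (Fin n))
    (hu : ∀ i, ‖u i‖ ≤ 1) :
    ENNReal.ofReal ((1 - Real.exp (-(ρ ^ 2) / 2)) ^ m) ≤
      stdGaussian n {y : EuclideanSpace ℝ (Fin n) | ∀ i, |⟪u i, y⟫| ≤ ρ} := by
  have h0 : 0 ≤ 1 - Real.exp (-(ρ ^ 2) / 2) := by
    rw [sub_nonneg, Real.exp_le_one_iff]
    linarith [sq_nonneg ρ]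
  induction m with
  | zero =>
    have : {y : EuclideanSpace ℝ (Fin n) | ∀ i, |⟪u i, y⟫| ≤ ρ} = univ :=
      eq_univ_of_forall fun y i => i.elim0
    rw [this, stdGaussian_eq, measure_univ]
    simp
  | succ m ih =>
    set K := {y : EuclideanSpace ℝ (Fin n) | ∀ i : Fin m, |⟪u i.succ, y⟫| ≤ ρ} with hK
    have e : {y : EuclideanSpace ℝ (Fin n) | ∀ i, |⟪u i, y⟫| ≤ ρ} =
        K ∩ {y | |⟪u 0, y⟫| ≤ ρ} := by
      ext y
      exact Fin.forall_fin_succ.trans and_comm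
    have eK : K = ⋂ i : Fin m, {y | |⟪u i.succ, y⟫| ≤ ρ} := by
      ext y
      simp [hK]
    have mK : MeasurableSet K := by
      rw [eK]
      exact MeasurableSet.iInter fun i => measurableSet_le (by fun_prop) measurable_const
    have cK : Convex ℝ K := by
      rw [eK]
      refine convex_iInter fun i => ?_
      have : {y | |⟪u i.succ, y⟫| ≤ ρ} = innerₛₗ ℝ (u i.succ) ⁻¹' Icc (-ρ) ρ := by
        ext y
        exact abs_le (a := ⟪u i.succ, y⟫)
      rw [this]
      exact (convex_Icc _ _).linear_preimage _
    have sK : ∀ y ∈ K, -y ∈ K := fun y hy i => by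
      rw [inner_neg_right, abs_neg]
      exact hy i
    rw [e, pow_succ, ENNReal.ofReal_mul (pow_nonneg h0 m)]
    exact (mul_le_mul_left (ih (fun i => u i.succ) fun i => hu i.succ) _).trans
      (stdGaussian_mul_le_inter_slab mK cK sK (hu 0) hρ)
end
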